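/- arXiv:0712.3865 — 10 statements merged into one kernel-verified Lean document; each statement's English description precedes it below -/
import Mathlib

section
/- Let N ≥ 2 and let a₁, …, a_N be real numbers such that a_j² ≠ a_k² whenever j ≠ k. Then for every t ∈ ℝ one has (φ_{a₁} ∗ ⋯ ∗ φ_{a_N})(t) = Σ_{j=1}^{N} (∏_{k ≠ j} (a_k² − a_j²)^{-1}) · φ_{a_j}(t), where ∗ denotes convolution of functions on ℝ. -/
open MeasureTheory Finset

/-- `phi a t = sin(t a)/a` for `t ≥ 0` (with `phi 0 t = t` for `t ≥ 0`), and `0` for `t < 0`. -/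
noncomputable def phi (a : ℝ) (t : ℝ) : ℝ :=
  if 0 ≤ t then (if a = 0 then t else Real.sin (t * a) / a) else 0

/-- Convolution of functions on `ℝ`. -/
noncomputable def conv (f g : ℝ → ℝ) (t : ℝ) : ℝ := ∫ s : ℝ, f (t - s) * g s

/-- `iterConvPhi a k = phi (a 0) ∗ phi (a 1) ∗ ⋯ ∗ phi (a k)` (a convolution of `k+1` functions). -/
noncomputable def iterConvPhi (a : ℕ → ℝ) : ℕ → (ℝ → ℝ)
  | 0 => phi (a 0)
  | k + 1 => conv (iterConvPhi a k) (phi (a (k + 1)))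

/-- The smooth function agreeing with `phi a` on `t ≥ 0`. -/
noncomputable def sa (a t : ℝ) : ℝ := if a = 0 then t else Real.sin (t * a) / a

lemma sa_hasDeriv (a t : ℝ) : HasDerivAt (sa a) (Real.cos (t * a)) t := by
  unfold sa
  by_cases h : a = 0
  · simp only [h, if_true, mul_zero, Real.cos_zero]
    exact hasDerivAt_id t
  · simp only [h, if_false]
    have h1 : HasDerivAt (fun t : ℝ => t * a) a t := by
      simpa using (hasDerivAt_id t).mul_const a
    have h2 := (h1.sin).div_const a
    rw [mul_div_cancel_right₀ _ h] at h2
    exact h2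

lemma ca_hasDeriv (a t : ℝ) :
    HasDerivAt (fun t : ℝ => Real.cos (t * a)) (-(a ^ 2) * sa a t) t := by
  have h1 : HasDerivAt (fun t : ℝ => t * a) a t := by
    simpa using (hasDerivAt_id t).mul_const a
  have h2 := h1.cos
  convert h2 using 1
  unfold sa
  by_cases h : a = 0
  · simp [h]
  · simp only [h, if_false]
    field_simp

lemma sa_cont (a : ℝ) : Continuous (sa a) :=
  continuous_iff_continuousAt.2 fun t => (sa_hasDeriv a t).continuousAt

lemma sa_zero (a : ℝ) : sa a 0 = 0 := by simp [sa]

lemma integrand_eq (a b t : ℝ) :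
    (fun s => phi a (t - s) * phi b s) =
      (Set.Icc 0 t).indicator (fun s => sa a (t - s) * sa b s) := by
  funext s
  by_cases h : s ∈ Set.Icc 0 t
  · rw [Set.indicator_of_mem h]
    have h1 : 0 ≤ t - s := sub_nonneg.2 h.2
    simp [phi, sa, h1, h.1]
  · rw [Set.indicator_of_notMem h]
    by_cases h0 : 0 ≤ s
    · have h1 : ¬ 0 ≤ t - s := fun h' => h ⟨h0, sub_nonneg.1 h'⟩
      simp [phi, h1]
    · simp [phi, h0]

lemma prod_cont (a b t : ℝ) : Continuous (fun s => sa a (t - s) * sa b s) :=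
  ((sa_cont a).comp (continuous_const.sub continuous_id)).mul (sa_cont b)

lemma integrand_int (a b t : ℝ) : Integrable (fun s => phi a (t - s) * phi b s) := by
  rw [integrand_eq, integrable_indicator_iff measurableSet_Icc]
  exact (prod_cont a b t).continuousOn.integrableOn_Icc

lemma conv_phi (a b t : ℝ) (hab : a ^ 2 ≠ b ^ 2) :
    ∫ s, phi a (t - s) * phi b s = (b ^ 2 - a ^ 2)⁻¹ * (phi a t - phi b t) := by
  rw [integrand_eq, integral_indicator measurableSet_Icc]
  by_cases ht : 0 ≤ t
  · rw [integral_Icc_eq_integral_Ioc, ← intervalIntegral.integral_of_le ht]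
    have hne : b ^ 2 - a ^ 2 ≠ 0 := sub_ne_zero.2 hab.symm
    have hd : ∀ s ∈ Set.uIcc 0 t, HasDerivAt
        (fun s => sa a (t - s) * Real.cos (s * b) + Real.cos ((t - s) * a) * sa b s)
        ((a ^ 2 - b ^ 2) * (sa a (t - s) * sa b s)) s := by
      intro s _
      have hs : HasDerivAt (fun s : ℝ => t - s) (-1) s := by
        simpa using (hasDerivAt_id s).const_sub t
      have h1 := (sa_hasDeriv a (t - s)).comp s hs
      have h2 := (ca_hasDeriv a (t - s)).comp s hs
      have h3 := (h1.mul (ca_hasDeriv b s)).add (h2.mul (sa_hasDeriv b s))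
      refine HasDerivAt.congr_deriv h3 ?_
      simp only [Function.comp]
      ring
    have := intervalIntegral.integral_eq_sub_of_hasDerivAt hd
      ((continuous_const.mul (prod_cont a b t)).intervalIntegrable _ _)
    rw [intervalIntegral.integral_const_mul] at this
    simp only [sub_self, sub_zero, sa_zero, zero_mul, mul_zero, Real.cos_zero, mul_one, one_mul,
      zero_add, add_zero] at this
    have e1 : phi a t = sa a t := by simp [phi, sa, ht]
    have e2 : phi b t = sa b t := by simp [phi, sa, ht]
    rw [e1, e2, eq_inv_mul_iff_mul_eq₀ hne]
    linarith
  · have : Set.Icc 0 t = ∅ := Set.Icc_eq_empty ht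
    simp [this, phi, ht]

lemma lagr (n : ℕ) (x : ℕ → ℝ) (hn : 1 ≤ n)
    (hx : ∀ j k, j < n + 1 → k < n + 1 → j ≠ k → x j ≠ x k) :
    ∑ j ∈ Finset.range n, (∏ k ∈ (Finset.range n).erase j, (x k - x j)⁻¹) * (x j - x n)⁻¹
      = ∏ k ∈ Finset.range n, (x k - x n)⁻¹ := by
  have hinj : Set.InjOn (fun i => - x i) (Finset.range n : Set ℕ) := by
    intro i hi j hj hij
    by_contra hne
    simp only [Finset.coe_range, Set.mem_Iio] at hi hj
    exact hx i j (by omega) (by omega) hne (neg_injective hij)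
  have hne : (Finset.range n).Nonempty := ⟨0, by simp; omega⟩
  have hnode : ∀ i ∈ Finset.range n, - x n ≠ - x i := by
    intro i hi h
    have := Finset.mem_range.1 hi
    exact hx n i (by omega) (by omega) (by omega) (neg_injective h)
  have key := Lagrange.eval_interpolate_not_at_node (s := Finset.range n)
    (v := fun i => - x i) (fun _ => (1 : ℝ)) (x := - x n) hnode
  have h1 : Lagrange.interpolate (Finset.range n) (fun i => - x i) (fun _ => (1 : ℝ)) = 1 :=
    Lagrange.interpolate_one hinj hne
  rw [h1, Polynomial.eval_one, Lagrange.eval_nodal] at key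
  rw [Finset.prod_inv_distrib]
  apply eq_inv_of_mul_eq_one_right
  rw [key]
  congr 1
  · exact Finset.prod_congr rfl fun i _ => by ring
  · refine Finset.sum_congr rfl fun i _ => ?_
    unfold Lagrange.nodalWeight
    rw [mul_one]
    congr 1
    · exact Finset.prod_congr rfl fun i _ => by congr 1; ring
    · congr 1; ring

lemma main_aux (a : ℕ → ℝ) (n : ℕ)
    (ha : ∀ j k, j < n + 1 → k < n + 1 → j ≠ k → (a j) ^ 2 ≠ (a k) ^ 2) :
    ∀ t, iterConvPhi a n t =
      ∑ j ∈ Finset.range (n + 1),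
        (∏ k ∈ (Finset.range (n + 1)).erase j, ((a k) ^ 2 - (a j) ^ 2)⁻¹) * phi (a j) t := by
  induction n with
  | zero => intro t; simp [iterConvPhi]
  | succ n ih =>
    intro t
    have ih' := ih fun j k hj hk => ha j k (by omega) (by omega)
    simp only [iterConvPhi, conv, ih', Finset.sum_mul, mul_assoc]
    rw [integral_finsetSum _ fun j _ => (integrand_int (a j) (a (n + 1)) t).const_mul _]
    simp only [integral_const_mul]
    rw [Finset.sum_range_succ _ (n + 1)]
    have herase : (Finset.range (n + 1 + 1)).erase (n + 1) = Finset.range (n + 1) := by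
      rw [Finset.range_add_one, Finset.erase_insert (by simp)]
    rw [herase, ← lagr (n + 1) (fun i => a i ^ 2) (by omega) ha, Finset.sum_mul,
      ← Finset.sum_add_distrib]
    refine Finset.sum_congr rfl fun j hj => ?_
    have hj' := Finset.mem_range.1 hj
    rw [conv_phi _ _ _ (ha j (n + 1) (by omega) (by omega) (by omega))]
    have he : (Finset.range (n + 1 + 1)).erase j
        = insert (n + 1) ((Finset.range (n + 1)).erase j) := by
      rw [Finset.range_add_one, Finset.erase_insert_of_ne (by omega)]
    rw [he, Finset.prod_insert (by simp)]
    have : (a j ^ 2 - a (n + 1) ^ 2)⁻¹ = - (a (n + 1) ^ 2 - a j ^ 2)⁻¹ := by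
      rw [← inv_neg, neg_sub]
    simp only [this]
    ring

theorem stmt_0 (N : ℕ) (hN : 2 ≤ N) (a : ℕ → ℝ)
    (ha : ∀ j k, j < N → k < N → j ≠ k → (a j) ^ 2 ≠ (a k) ^ 2) (t : ℝ) :
    iterConvPhi a (N - 1) t =
      ∑ j ∈ Finset.range N,
        (∏ k ∈ (Finset.range N).erase j, ((a k) ^ 2 - (a j) ^ 2)⁻¹) * phi (a j) t := by
  obtain ⟨n, rfl⟩ : ∃ n, N = n + 1 := ⟨N - 1, by omega⟩
  exact main_aux a n ha t
end

section
/- Let N ≥ 2, let a₁, …, a_N ∈ ℝ and let σ ∈ ℂ with Re σ > 0. Then F(a₁, …, a_N; σ) = (1/2) ∏_{j=1}^{N-1} (a_j² − (a_N − iσ)²)^{-1} + (1/2) ∏_{j=1}^{N-1} (a_j² − (a_N + iσ)²)^{-1}. -/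
open MeasureTheory Finset Complex

/-- `Ffun N a σ = ∫₀^∞ (φ_{a 0} ∗ ⋯ ∗ φ_{a (N-2)})(t) cos(t · a (N-1)) e^{-σ t} dt`,
where for `N = 2` the iterated convolution is just `φ_{a 0}`. -/
noncomputable def Ffun (N : ℕ) (a : ℕ → ℝ) (σ : ℂ) : ℂ :=
  ∫ t in Set.Ioi (0 : ℝ),
    ((iterConvPhi a (N - 2) t * Real.cos (t * a (N - 1)) : ℝ) : ℂ) * Complex.exp (-σ * t)

lemma phi_neg (a t : ℝ) (h : t < 0) : phi a t = 0 := by simp [phi, not_le.mpr h]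

lemma iter_neg (a : ℕ → ℝ) (k : ℕ) : ∀ t < 0, iterConvPhi a k t = 0 := by
  induction k with
  | zero => intro t h; exact phi_neg _ _ h
  | succ k ih =>
    intro t h
    simp only [iterConvPhi, conv]
    have : ∀ s, iterConvPhi a k (t - s) * phi (a (k+1)) s = 0 := by
      intro s
      rcases lt_or_ge s 0 with hs | hs
      · rw [phi_neg _ _ hs, mul_zero]
      · rw [ih _ (by linarith), zero_mul]
    simp [this]

lemma base_Ioi (a : ℝ) (p : ℂ) (hp : 0 < p.re) :
    IntegrableOn (fun t : ℝ => ((phi a t : ℝ) : ℂ) * Complex.exp (-p * t)) (Set.Ioi 0) ∧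
    ∫ t in Set.Ioi (0:ℝ), ((phi a t : ℝ) : ℂ) * Complex.exp (-p * t) = ((a : ℂ)^2 + p^2)⁻¹ := by
  by_cases ha : a = 0
  · subst ha
    have hc : ∀ t ∈ Set.Ioi (0:ℝ), ((phi 0 t : ℝ) : ℂ) * Complex.exp (-p * t)
        = (t:ℂ) * Complex.exp (-p * t) := by
      intro t ht
      have ht' : (0:ℝ) ≤ t := le_of_lt ht
      simp [phi, ht']
    have hp0 : p ≠ 0 := fun h => by rw [h] at hp; simp at hp
    have hint : IntegrableOn (fun t : ℝ => ((phi 0 t : ℝ) : ℂ) * Complex.exp (-p * t))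
        (Set.Ioi 0) := by
      have h := integrableOn_rpow_mul_exp_neg_mul_rpow (s := 1) (p := 1) (b := p.re)
        (by norm_num) one_pos hp
      refine Integrable.mono' h ?_ ?_
      · refine (Measurable.aestronglyMeasurable ?_)
        refine Measurable.mul ?_ (by fun_prop)
        refine Complex.measurable_ofReal.comp ?_
        unfold phi
        exact Measurable.ite measurableSet_Ici (by simp; fun_prop) measurable_const
      · filter_upwards [ae_restrict_mem measurableSet_Ioi] with t ht
        have ht' : (0:ℝ) ≤ t := le_of_lt ht
        simp [phi, ht', Complex.norm_exp, abs_of_nonneg ht']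
    refine ⟨hint, ?_⟩
    rw [setIntegral_congr_fun measurableSet_Ioi hc]
    have hd : ∀ t ∈ Set.Ici (0:ℝ), HasDerivAt
        (fun t : ℝ => -((t:ℂ) / p + 1 / p ^ 2) * Complex.exp (-p * t))
        ((t:ℂ) * Complex.exp (-p * t)) t := by
      intro t _
      have d1 : HasDerivAt (fun t : ℝ => (t:ℂ)) 1 t := Complex.ofRealCLM.hasDerivAt
      have d2 := (((d1.div_const p).add_const (1 / p ^ 2)).neg).mul ((d1.const_mul (-p)).cexp)
      refine d2.congr_deriv ?_
      simp only [Pi.neg_apply]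
      field_simp
      ring
    have ht : Filter.Tendsto (fun t : ℝ => -((t:ℂ) / p + 1 / p ^ 2) * Complex.exp (-p * t))
        Filter.atTop (nhds 0) := by
      have t1 : Filter.Tendsto (fun t : ℝ => (t:ℂ) * Complex.exp (-p * t))
          Filter.atTop (nhds 0) := by
        rw [tendsto_zero_iff_norm_tendsto_zero]
        have := tendsto_rpow_mul_exp_neg_mul_atTop_nhds_zero 1 p.re hp
        refine this.congr' ?_
        filter_upwards [Filter.eventually_ge_atTop 0] with t ht
        simp [Complex.norm_exp, abs_of_nonneg ht]
      have t0 : Filter.Tendsto (fun t : ℝ => Complex.exp (-p * t))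
          Filter.atTop (nhds 0) := by
        rw [tendsto_zero_iff_norm_tendsto_zero]
        have := tendsto_rpow_mul_exp_neg_mul_atTop_nhds_zero 0 p.re hp
        refine this.congr' ?_
        filter_upwards [Filter.eventually_ge_atTop 0] with t ht
        simp [Complex.norm_exp]
      have := (t1.const_mul (-(1/p))).add (t0.const_mul (-(1/p^2)))
      simp only [mul_zero, add_zero] at this
      refine this.congr ?_
      intro t
      ring
    rw [integral_Ioi_of_hasDerivAt_of_tendsto' hd (hint.congr_fun hc measurableSet_Ioi) ht]
    simp
  · have haC : (a:ℂ) ≠ 0 := by exact_mod_cast ha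
    have h1 : (-p + a * I).re < 0 := by simpa using hp
    have h2 : (-p - a * I).re < 0 := by simpa using hp
    have hc : ∀ t ∈ Set.Ioi (0:ℝ), ((phi a t : ℝ) : ℂ) * Complex.exp (-p * t)
        = (2 * I * a)⁻¹ * (Complex.exp ((-p + a * I) * t) - Complex.exp ((-p - a * I) * t)) := by
      intro t ht
      have ht' : (0:ℝ) ≤ t := le_of_lt ht
      have e1 : (-p + a * I) * t = (t * a) * I + (-p * t) := by ring
      have e2 : (-p - a * I) * t = -(t * a) * I + (-p * t) := by ring
      rw [e1, e2, Complex.exp_add, Complex.exp_add]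
      simp only [phi, ht', if_true, ha, if_false]
      push_cast
      rw [Complex.sin]
      have := Complex.I_sq
      field_simp
      rw [this]; ring
    have i1 := integrableOn_exp_mul_complex_Ioi h1 0
    have i2 := integrableOn_exp_mul_complex_Ioi h2 0
    constructor
    · exact IntegrableOn.congr_fun (Integrable.const_mul (i1.sub i2) _) (fun t ht => (hc t ht).symm) measurableSet_Ioi
    · rw [setIntegral_congr_fun measurableSet_Ioi hc, integral_const_mul, integral_sub i1 i2,
        integral_exp_mul_complex_Ioi h1, integral_exp_mul_complex_Ioi h2]
      have n1 : (-p + a * I) ≠ 0 := fun h => by rw [h] at h1; simp at h1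
      have n2 : (-p - a * I) ≠ 0 := fun h => by rw [h] at h2; simp at h2
      have e : (a:ℂ)^2 + p^2 = (-p + a * I) * (-p - a * I) := by
        linear_combination ((a:ℂ)^2) * Complex.I_sq
      rw [e]
      have n3 : (-p + a * I) - (-p - a * I) ≠ 0 := by
        ring_nf
        simp [haC, Complex.I_ne_zero]
      have e3 : 2 * I * (a:ℂ) = (-p + a * I) - (-p - a * I) := by ring
      simp only [Complex.ofReal_zero, mul_zero, Complex.exp_zero]
      rw [e3]
      generalize -p + (a:ℂ) * I = u at *
      generalize -p - (a:ℂ) * I = v at *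
      field_simp
      ring

lemma setInt_iff (f : ℝ → ℝ) (hf : ∀ t < 0, f t = 0) (g : ℝ → ℂ) :
    (IntegrableOn (fun t : ℝ => (f t : ℂ) * g t) (Set.Ioi 0) ↔
      Integrable (fun t : ℝ => (f t : ℂ) * g t)) ∧
    ∫ t in Set.Ioi (0:ℝ), (f t : ℂ) * g t = ∫ t : ℝ, (f t : ℂ) * g t := by
  have hs : ∀ t ∉ Set.Ici (0:ℝ), (f t : ℂ) * g t = 0 := by
    intro t ht
    rw [hf t (by simpa using ht)]; simp
  constructor
  · rw [← integrableOn_Ici_iff_integrableOn_Ioi]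
    refine integrableOn_iff_integrable_of_support_subset ?_
    intro t ht
    by_contra h
    exact ht (hs t h)
  · rw [← integral_Ici_eq_integral_Ioi]
    exact setIntegral_eq_integral_of_forall_compl_eq_zero hs

lemma laplace_iter (a : ℕ → ℝ) (p : ℂ) (hp : 0 < p.re) (k : ℕ) :
    Integrable (fun t : ℝ => ((iterConvPhi a k t : ℝ) : ℂ) * Complex.exp (-p * t)) ∧
    ∫ t : ℝ, ((iterConvPhi a k t : ℝ) : ℂ) * Complex.exp (-p * t)
      = ∏ j ∈ Finset.range (k+1), ((a j : ℂ)^2 + p^2)⁻¹ := by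
  have base : ∀ b : ℝ, Integrable (fun t : ℝ => ((phi b t : ℝ) : ℂ) * Complex.exp (-p * t)) ∧
      ∫ t : ℝ, ((phi b t : ℝ) : ℂ) * Complex.exp (-p * t) = ((b : ℂ)^2 + p^2)⁻¹ := by
    intro b
    have h := setInt_iff (phi b) (fun t => phi_neg b t) (fun t => Complex.exp (-p * t))
    have h' := base_Ioi b p hp
    exact ⟨h.1.1 h'.1, h.2 ▸ h'.2⟩
  induction k with
  | zero => simpa [iterConvPhi] using base (a 0)
  | succ k ih =>
    obtain ⟨b1, b2⟩ := base (a (k+1))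
    have key : (fun t : ℝ => ((iterConvPhi a (k+1) t : ℝ) : ℂ) * Complex.exp (-p * t)) =
      convolution (fun t : ℝ => ((iterConvPhi a k t : ℝ) : ℂ) * Complex.exp (-p * t))
        (fun t : ℝ => ((phi (a (k+1)) t : ℝ) : ℂ) * Complex.exp (-p * t))
        (ContinuousLinearMap.mul ℂ ℂ) volume := by
      funext t
      rw [convolution_mul_swap]
      simp only [iterConvPhi, conv]
      rw [← integral_complex_ofReal, ← integral_mul_const]
      congr 1
      funext s
      have : -p * (t:ℂ) = -p * ((t - s : ℝ) : ℂ) + -p * s := by push_cast; ring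
      rw [this, Complex.exp_add]
      push_cast
      ring
    rw [key]
    refine ⟨Integrable.integrable_convolution _ ih.1 b1, ?_⟩
    rw [integral_convolution _ ih.1 b1, ih.2, b2, Finset.prod_range_succ _ (k+1)]
    simp

theorem stmt_2 (N : ℕ) (hN : 2 ≤ N) (a : ℕ → ℝ) (σ : ℂ) (hσ : 0 < σ.re) :
    Ffun N a σ =
      (1 / 2) * ∏ j ∈ Finset.range (N - 1),
          (((a j : ℂ)) ^ 2 - ((a (N - 1) : ℂ) - Complex.I * σ) ^ 2)⁻¹ +
      (1 / 2) * ∏ j ∈ Finset.range (N - 1),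
          (((a j : ℂ)) ^ 2 - ((a (N - 1) : ℂ) + Complex.I * σ) ^ 2)⁻¹ := by
  obtain ⟨k, rfl⟩ := Nat.exists_eq_add_of_le' hN
  have e1 : k + 2 - 2 = k := by omega
  have e2 : k + 2 - 1 = k + 1 := by omega
  unfold Ffun
  rw [e1, e2]
  set b := a (k+1) with hb
  obtain ⟨i1, v1⟩ := laplace_iter a (σ + b * I) (by simpa using hσ) k
  obtain ⟨i2, v2⟩ := laplace_iter a (σ - b * I) (by simpa using hσ) k
  have h := (setInt_iff (iterConvPhi a k) (iter_neg a k)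
    (fun t => (Real.cos (t * b) : ℂ) * Complex.exp (-σ * t))).2
  have hc : ∀ t : ℝ, (iterConvPhi a k t : ℂ) * ((Real.cos (t * b) : ℂ) * Complex.exp (-σ * t))
      = (1/2) * ((iterConvPhi a k t : ℂ) * Complex.exp (-(σ + b * I) * t)) +
        (1/2) * ((iterConvPhi a k t : ℂ) * Complex.exp (-(σ - b * I) * t)) := by
    intro t
    have e1 : -(σ + b * I) * t = -(t * b) * I + (-σ * t) := by ring
    have e2 : -(σ - b * I) * t = (t * b) * I + (-σ * t) := by ring
    rw [e1, e2, Complex.exp_add, Complex.exp_add]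
    push_cast
    rw [Complex.cos]
    ring
  simp only [Complex.ofReal_mul, mul_assoc] at h ⊢
  simp only [← mul_assoc] at h ⊢
  rw [h]
  simp only [mul_assoc]
  simp_rw [hc]
  rw [integral_add (i1.const_mul _) (i2.const_mul _), integral_const_mul, integral_const_mul,
    v1, v2]
  have q1 : ((b:ℂ) - I * σ)^2 = -(σ + b * I)^2 := by
    linear_combination ((b:ℂ)^2 + σ^2) * Complex.I_sq
  have q2 : ((b:ℂ) + I * σ)^2 = -(σ - b * I)^2 := by
    linear_combination ((b:ℂ)^2 + σ^2) * Complex.I_sq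
  simp only [q1, q2, sub_neg_eq_add]
end

section
/- Let M ≥ 1, let t₁, …, t_M ∈ ℂ be pairwise distinct and let b ∈ ℂ be such that t_j² + b² ≠ 0 for every j. Then Σ_{j=1}^{M} (∏_{k ≠ j} (t_k − t_j)^{-1}) · t_j/(t_j² + b²) = (1/2) ∏_{j=1}^{M} (t_j − i b)^{-1} + (1/2) ∏_{j=1}^{M} (t_j + i b)^{-1}. -/
open Finset Complex

theorem aux_pf (M : ℕ) (hM : 1 ≤ M) (t : Fin M → ℂ) (ht : Function.Injective t)
    (x : ℂ) (hx : ∀ j, t j - x ≠ 0) :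
    ∑ j : Fin M, (∏ k ∈ Finset.univ.erase j, (t k - t j)⁻¹) * (t j - x)⁻¹ =
      ∏ j : Fin M, (t j - x)⁻¹ := by
  have hne : (Finset.univ : Finset (Fin M)).Nonempty := ⟨⟨0, hM⟩, Finset.mem_univ _⟩
  have h := congrArg (Polynomial.eval x) (Lagrange.sum_basis (ht.injOn (s := _)) hne)
  rw [Polynomial.eval_finsetSum, Polynomial.eval_one] at h
  rw [← mul_one (∏ j : Fin M, (t j - x)⁻¹), ← h, Finset.mul_sum]
  refine Finset.sum_congr rfl fun j _ => ?_
  rw [← Finset.mul_prod_erase _ _ (Finset.mem_univ j), mul_comm, mul_assoc]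
  congr 1
  rw [Lagrange.basis, Polynomial.eval_prod, ← Finset.prod_mul_distrib]
  refine Finset.prod_congr rfl fun k hk => ?_
  have hkj : t j - t k ≠ 0 := sub_ne_zero.2 fun e => (Finset.ne_of_mem_erase hk) (ht e).symm
  have hkj' : t k - t j ≠ 0 := sub_ne_zero.2 fun e => (Finset.ne_of_mem_erase hk) (ht e)
  have := hx k
  simp only [Lagrange.basisDivisor, Polynomial.eval_mul, Polynomial.eval_C, Polynomial.eval_sub,
    Polynomial.eval_X]
  rw [← neg_sub (t k) (t j), inv_neg, ← neg_sub (t k) x]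
  field_simp

theorem stmt_4 (M : ℕ) (hM : 1 ≤ M) (t : Fin M → ℂ) (ht : Function.Injective t)
    (b : ℂ) (hb : ∀ j, t j ^ 2 + b ^ 2 ≠ 0) :
    ∑ j : Fin M, (∏ k ∈ Finset.univ.erase j, (t k - t j)⁻¹) * (t j / (t j ^ 2 + b ^ 2)) =
      (1 / 2) * ∏ j : Fin M, (t j - Complex.I * b)⁻¹ +
      (1 / 2) * ∏ j : Fin M, (t j + Complex.I * b)⁻¹ := by
  have hf : ∀ j, t j ^ 2 + b ^ 2 = (t j - Complex.I * b) * (t j + Complex.I * b) := fun j => by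
    linear_combination b ^ 2 * Complex.I_sq
  have h1 : ∀ j, t j - Complex.I * b ≠ 0 := fun j e => hb j (by rw [hf, e, zero_mul])
  have h2 : ∀ j, t j + Complex.I * b ≠ 0 := fun j e => hb j (by rw [hf, e, mul_zero])
  have e1 := aux_pf M hM t ht (Complex.I * b) h1
  have e2 := aux_pf M hM t ht (-(Complex.I * b)) (by simpa using h2)
  simp only [sub_neg_eq_add] at e2
  rw [← e1, ← e2, Finset.mul_sum, Finset.mul_sum, ← Finset.sum_add_distrib]
  refine Finset.sum_congr rfl fun j _ => ?_
  have : t j / (t j ^ 2 + b ^ 2) =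
      (1 / 2) * (t j - Complex.I * b)⁻¹ + (1 / 2) * (t j + Complex.I * b)⁻¹ := by
    rw [hf]
    have := h1 j
    have := h2 j
    field_simp
    ring
  rw [this]
  ring
end

section
/- There exists a constant C > 0 and, for each positive integer N, a smooth compactly supported function χ_N : ℝ → ℝ such that χ_N(t) = 1 when |t| ≤ 1, χ_N(t) = 0 when |t| > 2, and |χ_N^{(k)}(t)| ≤ C^k N^k for all t ∈ ℝ and all integers k with 0 ≤ k ≤ 2N + 2; here C does not depend on N. -/
open MeasureTheory in
theorem avg_hasDerivAt (h : ℝ) (f : ℝ → ℝ) (hf : Continuous f) (t : ℝ) :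
    HasDerivAt (fun t => (2 * h)⁻¹ * ∫ x in (t - h)..(t + h), f x)
      ((2 * h)⁻¹ * (f (t + h) - f (t - h))) t := by
  have key : ∀ u : ℝ, HasDerivAt (fun u => ∫ x in (0 : ℝ)..u, f x) (f u) u := fun u =>
    intervalIntegral.integral_hasDerivAt_right (hf.intervalIntegrable _ _)
      hf.aestronglyMeasurable.stronglyMeasurableAtFilter hf.continuousAt
  have h1 := (key (t + h)).comp_add_const t h
  have h2 := (key (t - h)).comp_sub_const t h
  have h3 := (h1.sub h2).const_mul ((2 * h)⁻¹)
  refine h3.congr_of_eventuallyEq (Filter.Eventually.of_forall fun s => ?_)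
  simp only [Pi.sub_apply]
  rw [intervalIntegral.integral_interval_sub_left (hf.intervalIntegrable _ _)
    (hf.intervalIntegrable _ _)]

theorem avg_step (h : ℝ) (hh : 0 < h) (j : ℕ) (a b : ℝ) (f : ℝ → ℝ)
    (hf : ContDiff ℝ (⊤ : ℕ∞) f) (h1 : ∀ t : ℝ, |t| ≤ a → f t = 1)
    (h0 : ∀ t : ℝ, b ≤ |t| → f t = 0)
    (hb : ∀ k : ℕ, k ≤ j → ∀ t : ℝ, |iteratedDeriv k f t| ≤ h⁻¹ ^ k) :
    ∃ g : ℝ → ℝ, ContDiff ℝ (⊤ : ℕ∞) g ∧ (∀ t : ℝ, |t| ≤ a - h → g t = 1) ∧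
      (∀ t : ℝ, b + h ≤ |t| → g t = 0) ∧
      (∀ k : ℕ, k ≤ j + 1 → ∀ t : ℝ, |iteratedDeriv k g t| ≤ h⁻¹ ^ k) := by
  have hd := avg_hasDerivAt h f hf.continuous
  have hderiv := funext fun t => (hd t).deriv
  have hp : ContDiff ℝ (⊤ : ℕ∞) (fun t => f (t + h)) := hf.comp (contDiff_id.add contDiff_const)
  have hm : ContDiff ℝ (⊤ : ℕ∞) (fun t => f (t - h)) := hf.comp (contDiff_id.sub contDiff_const)
  refine ⟨fun t => (2 * h)⁻¹ * ∫ x in (t - h)..(t + h), f x, ?_, ?_, ?_, ?_⟩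
  · rw [contDiff_infty_iff_deriv]
    refine ⟨fun t => (hd t).differentiableAt, ?_⟩
    rw [hderiv]
    exact contDiff_const.mul (hp.sub hm)
  · intro t ht
    have : ∫ x in (t - h)..(t + h), f x = ∫ x in (t - h)..(t + h), (1 : ℝ) := by
      apply intervalIntegral.integral_congr
      intro x hx
      rw [Set.uIcc_of_le (by linarith)] at hx
      apply h1
      have := abs_le.1 ht
      rw [abs_le]
      constructor <;> linarith [hx.1, hx.2]
    simp only [this, intervalIntegral.integral_const, smul_eq_mul]
    field_simp
    ring
  · intro t ht
    have : ∫ x in (t - h)..(t + h), f x = ∫ x in (t - h)..(t + h), (0 : ℝ) := by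
      apply intervalIntegral.integral_congr
      intro x hx
      rw [Set.uIcc_of_le (by linarith)] at hx
      apply h0
      have h4 : |t - x| ≤ h := abs_le.2 ⟨by linarith [hx.2], by linarith [hx.1]⟩
      linarith [abs_sub_abs_le_abs_sub t x]
    simp [this]
  · intro k hk t
    rcases k with _ | k
    · have hf1 : ∀ x, ‖f x‖ ≤ 1 := fun x => by simpa using hb 0 (Nat.zero_le _) x
      have := intervalIntegral.norm_integral_le_of_norm_le_const
        (a := t - h) (b := t + h) (f := f) (C := 1) (fun x _ => hf1 x)
      simp only [iteratedDeriv_zero, pow_zero, abs_mul]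
      rw [Real.norm_eq_abs, show t + h - (t - h) = 2 * h by ring,
        abs_of_pos (show 0 < 2 * h by linarith), one_mul] at this
      rw [abs_of_pos (show 0 < (2 * h)⁻¹ by positivity), inv_mul_le_iff₀ (by positivity)]
      linarith
    · rw [iteratedDeriv_succ', hderiv, iteratedDeriv_const_mul_field]
      have hle : ((k : ℕ∞) : WithTop ℕ∞) ≤ ((⊤ : ℕ∞) : WithTop ℕ∞) := by
        exact_mod_cast le_top
      have e : iteratedDeriv k (fun t => f (t + h) - f (t - h)) t
          = iteratedDeriv k f (t + h) - iteratedDeriv k f (t - h) := by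
        rw [iteratedDeriv_fun_sub ((hp.of_le hle).contDiffAt) ((hm.of_le hle).contDiffAt)]
        rw [iteratedDeriv_comp_add_const, iteratedDeriv_comp_sub_const]
      rw [e, abs_mul, abs_of_pos (show 0 < (2 * h)⁻¹ by positivity),
        inv_mul_le_iff₀ (by positivity)]
      have e1 := hb k (by omega) (t + h)
      have e2 := hb k (by omega) (t - h)
      have e3 : 2 * h * h⁻¹ ^ (k + 1) = 2 * h⁻¹ ^ k := by
        rw [pow_succ]; field_simp
      rw [e3]
      linarith [abs_sub (iteratedDeriv k f (t + h)) (iteratedDeriv k f (t - h))]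

theorem avg_iter (h : ℝ) (hh : 0 < h) (j : ℕ) :
    ∃ g : ℝ → ℝ, ContDiff ℝ (⊤ : ℕ∞) g ∧ (∀ t : ℝ, |t| ≤ 5 / 4 - j * h → g t = 1) ∧
      (∀ t : ℝ, 7 / 4 + j * h ≤ |t| → g t = 0) ∧
      (∀ k : ℕ, k ≤ j → ∀ t : ℝ, |iteratedDeriv k g t| ≤ h⁻¹ ^ k) := by
  induction j with
  | zero =>
    let φ : ContDiffBump (0 : ℝ) := ⟨5 / 4, 7 / 4, by norm_num, by norm_num⟩
    refine ⟨φ, φ.contDiff, ?_, ?_, ?_⟩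
    · intro t ht
      apply φ.one_of_mem_closedBall
      simpa [φ] using ht
    · intro t ht
      apply φ.zero_of_le_dist
      simpa [φ] using ht
    · intro k hk t
      obtain rfl : k = 0 := by omega
      simp only [iteratedDeriv_zero, pow_zero]
      rw [abs_of_nonneg φ.nonneg]
      exact φ.le_one
  | succ j ih =>
    obtain ⟨f, hf, h1, h0, hb⟩ := ih
    obtain ⟨g, hg, g1, g0, gb⟩ := avg_step h hh j _ _ f hf h1 h0 hb
    refine ⟨g, hg, fun t ht => g1 t ?_, fun t ht => g0 t ?_, gb⟩
    · push_cast at ht; linarith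
    · push_cast at ht; linarith

theorem stmt_5 :
    ∃ C : ℝ, 0 < C ∧ ∀ N : ℕ, 0 < N → ∃ χ : ℝ → ℝ,
      ContDiff ℝ (⊤ : ℕ∞) χ ∧ HasCompactSupport χ ∧
      (∀ t : ℝ, |t| ≤ 1 → χ t = 1) ∧
      (∀ t : ℝ, |t| > 2 → χ t = 0) ∧
      (∀ k : ℕ, k ≤ 2 * N + 2 → ∀ t : ℝ, |iteratedDeriv k χ t| ≤ C ^ k * (N : ℝ) ^ k) := by
  refine ⟨16, by norm_num, fun N hN => ?_⟩
  have hN' : (1 : ℝ) ≤ N := by exact_mod_cast hN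
  obtain ⟨g, hg, g1, g0, gb⟩ := avg_iter (8 * (N : ℝ) + 8)⁻¹ (by positivity) (2 * N + 2)
  have e : ((2 * N + 2 : ℕ) : ℝ) * (8 * (N : ℝ) + 8)⁻¹ = 1 / 4 := by
    push_cast; field_simp; ring
  rw [e] at g1 g0
  refine ⟨g, hg, ?_, fun t ht => g1 t (by linarith), fun t ht => g0 t (by linarith), ?_⟩
  · apply HasCompactSupport.intro (isCompact_closedBall (0 : ℝ) 2)
    intro x hx
    apply g0
    simp at hx
    linarith
  · intro k hk t
    refine (gb k hk t).trans ?_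
    rw [inv_inv, ← mul_pow]
    gcongr
    linarith
end

section
/- For every C₀ > 0 there exists C > 0 such that the following holds: for every positive integer N, every smooth function χ : ℝ → ℝ supported in [−2, 2] satisfying |χ^{(k)}(t)| ≤ C₀^k N^k for all t ∈ ℝ and all 0 ≤ k ≤ 2N + 2, and every γ > 0 and τ ∈ ℝ, one has |∫_ℝ χ(t) e^{t(γ + iτ)} dt| ≤ C^N N^{2N+2} e^{2γ} (γ + |τ|)^{-(2N+2)}. -/
open MeasureTheory Complex

lemma aux_supp (f : ℝ → ℝ) (h : ∀ t : ℝ, t ∉ Set.Icc (-2 : ℝ) 2 → f t = 0) :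
    ∀ t : ℝ, t ∉ Set.Icc (-2 : ℝ) 2 → deriv f t = 0 := by
  intro t ht
  have : f =ᶠ[nhds t] fun _ => (0 : ℝ) := by
    filter_upwards [isClosed_Icc.isOpen_compl.mem_nhds ht] with s hs
    exact h s hs
  rw [this.deriv_eq]
  simp

lemma aux_int (f : ℝ → ℝ) (hf : Continuous f) (h : ∀ t : ℝ, t ∉ Set.Icc (-2 : ℝ) 2 → f t = 0)
    (g : ℝ → ℂ) (hg : Continuous g) : Integrable (fun t => (f t : ℂ) * g t) := by
  apply Continuous.integrable_of_hasCompactSupport (by fun_prop)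
  apply HasCompactSupport.intro (isCompact_Icc (a := (-2 : ℝ)) (b := 2))
  intro t ht
  simp [h t ht]

lemma aux_step (f : ℝ → ℝ) (hf : ContDiff ℝ (⊤ : ℕ∞) f)
    (h : ∀ t : ℝ, t ∉ Set.Icc (-2 : ℝ) 2 → f t = 0) (z : ℂ) :
    ‖z‖ * ‖∫ t : ℝ, (f t : ℂ) * Complex.exp ((t : ℂ) * z)‖ =
      ‖∫ t : ℝ, ((deriv f t : ℝ) : ℂ) * Complex.exp ((t : ℂ) * z)‖ := by
  have hd : Continuous (deriv f) := hf.continuous_deriv (by simp)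
  have key := integral_mul_deriv_eq_deriv_mul_of_integrable
    (u := fun t : ℝ => (f t : ℂ)) (u' := fun t : ℝ => ((deriv f t : ℝ) : ℂ))
    (v := fun t : ℝ => Complex.exp ((t : ℂ) * z))
    (v' := fun t : ℝ => Complex.exp ((t : ℂ) * z) * z)
    (fun t _ => ((hf.differentiable (by simp)) t).hasDerivAt.ofReal_comp)
    (fun t _ => by
      have h1 : HasDerivAt (fun t : ℝ => (t : ℂ) * z) z t := by
        simpa using (Complex.ofRealCLM.hasDerivAt (x := t)).mul_const z
      exact h1.cexp)
    (aux_int f hf.continuous h _ (by fun_prop))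
    (aux_int _ hd (aux_supp f h) _ (by fun_prop))
    (aux_int f hf.continuous h _ (by fun_prop))
  have e : (∫ t : ℝ, (f t : ℂ) * (Complex.exp ((t : ℂ) * z) * z)) =
      (∫ t : ℝ, (f t : ℂ) * Complex.exp ((t : ℂ) * z)) * z := by
    rw [← integral_mul_const]
    simp only [mul_assoc]
  rw [e] at key
  rw [mul_comm, ← norm_mul, key, norm_neg]

lemma aux_iter (k : ℕ) : ∀ (f : ℝ → ℝ), ContDiff ℝ (⊤ : ℕ∞) f →
    (∀ t : ℝ, t ∉ Set.Icc (-2 : ℝ) 2 → f t = 0) → ∀ (z : ℂ),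
    ‖z‖ ^ k * ‖∫ t : ℝ, (f t : ℂ) * Complex.exp ((t : ℂ) * z)‖ =
      ‖∫ t : ℝ, ((iteratedDeriv k f t : ℝ) : ℂ) * Complex.exp ((t : ℂ) * z)‖ ∧
    (∀ t : ℝ, t ∉ Set.Icc (-2 : ℝ) 2 → iteratedDeriv k f t = 0) := by
  induction k with
  | zero => intro f hf h z; simpa using h
  | succ k ih =>
    intro f hf h z
    have hd : ContDiff ℝ (⊤ : ℕ∞) (deriv f) := (contDiff_infty_iff_deriv.1 hf).2
    obtain ⟨h1, h2⟩ := ih (deriv f) hd (aux_supp f h) z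
    rw [iteratedDeriv_succ', ← h1, ← aux_step f hf h z]
    exact ⟨by ring, h2⟩

theorem stmt_6 (C₀ : ℝ) (hC₀ : 0 < C₀) :
    ∃ C : ℝ, 0 < C ∧ ∀ N : ℕ, 0 < N → ∀ χ : ℝ → ℝ,
      ContDiff ℝ (⊤ : ℕ∞) χ →
      (∀ t : ℝ, t ∉ Set.Icc (-2 : ℝ) 2 → χ t = 0) →
      (∀ k : ℕ, k ≤ 2 * N + 2 → ∀ t : ℝ, |iteratedDeriv k χ t| ≤ C₀ ^ k * (N : ℝ) ^ k) →
      ∀ γ : ℝ, 0 < γ → ∀ τ : ℝ,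
        ‖∫ t : ℝ, (χ t : ℂ) * Complex.exp ((t : ℂ) * ((γ : ℂ) + (τ : ℂ) * Complex.I))‖ ≤
          C ^ N * (N : ℝ) ^ (2 * N + 2) * Real.exp (2 * γ) * ((γ + |τ|) ^ (2 * N + 2))⁻¹ := by
  refine ⟨4 * (1 + 2 * C₀) ^ 4, by positivity, ?_⟩
  intro N hN χ hχ hs hb γ hγ τ
  set z : ℂ := (γ : ℂ) + (τ : ℂ) * Complex.I with hz
  have hre : z.re = γ := by simp [hz]
  have him : z.im = τ := by simp [hz]
  obtain ⟨h1, h2⟩ := aux_iter (2 * N + 2) χ hχ hs z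
  set J := ‖∫ t : ℝ, (χ t : ℂ) * Complex.exp ((t : ℂ) * z)‖ with hJ
  have hJ0 : 0 ≤ J := norm_nonneg _
  have hB : ‖∫ t : ℝ, ((iteratedDeriv (2 * N + 2) χ t : ℝ) : ℂ) * Complex.exp ((t : ℂ) * z)‖ ≤
      C₀ ^ (2 * N + 2) * (N : ℝ) ^ (2 * N + 2) * Real.exp (2 * γ) * 4 := by
    rw [← setIntegral_eq_integral_of_forall_compl_eq_zero (s := Set.Icc (-2 : ℝ) 2)
      (fun t ht => by simp [h2 t ht])]
    have := norm_setIntegral_le_of_norm_le_const (μ := volume) (s := Set.Icc (-2 : ℝ) 2)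
      (f := fun t : ℝ => ((iteratedDeriv (2 * N + 2) χ t : ℝ) : ℂ) * Complex.exp ((t : ℂ) * z))
      (C := C₀ ^ (2 * N + 2) * (N : ℝ) ^ (2 * N + 2) * Real.exp (2 * γ))
      measure_Icc_lt_top (fun t ht => by
        rw [norm_mul, Complex.norm_exp, Complex.norm_real, Real.norm_eq_abs]
        apply mul_le_mul (hb _ le_rfl t) _ (Real.exp_pos _).le (by positivity)
        apply Real.exp_le_exp.2
        simp only [Complex.mul_re, Complex.ofReal_re, Complex.ofReal_im, hre]
        nlinarith [ht.2])
    refine this.trans (le_of_eq ?_)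
    rw [Measure.real, Real.volume_Icc]
    norm_num
  have hzn : γ + |τ| ≤ 2 * ‖z‖ := by
    have a := Complex.abs_re_le_norm z
    have b := Complex.abs_im_le_norm z
    rw [hre, abs_of_pos hγ] at a
    rw [him] at b
    linarith
  have hpos : 0 < γ + |τ| := by positivity
  rw [← div_eq_mul_inv, le_div_iff₀ (by positivity)]
  have hp : (γ + |τ|) ^ (2 * N + 2) ≤ 2 ^ (2 * N + 2) * ‖z‖ ^ (2 * N + 2) := by
    rw [← mul_pow]
    exact pow_le_pow_left₀ hpos.le hzn _
  have hc : (2 * C₀) ^ (2 * N + 2) * 4 ≤ (4 * (1 + 2 * C₀) ^ 4) ^ N := by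
    rw [mul_pow 4, ← pow_mul, mul_comm]
    apply mul_le_mul _ _ (by positivity) (by positivity)
    · exact le_self_pow₀ (by norm_num) hN.ne'
    · calc (2 * C₀) ^ (2 * N + 2) ≤ (1 + 2 * C₀) ^ (2 * N + 2) :=
            pow_le_pow_left₀ (by positivity) (by linarith) _
        _ ≤ _ := pow_le_pow_right₀ (by linarith) (by omega)
  calc J * (γ + |τ|) ^ (2 * N + 2) ≤ J * (2 ^ (2 * N + 2) * ‖z‖ ^ (2 * N + 2)) := by gcongr
    _ = 2 ^ (2 * N + 2) * (‖z‖ ^ (2 * N + 2) * J) := by ring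
    _ ≤ 2 ^ (2 * N + 2) *
        (C₀ ^ (2 * N + 2) * (N : ℝ) ^ (2 * N + 2) * Real.exp (2 * γ) * 4) := by
        rw [h1]; gcongr
    _ = ((2 * C₀) ^ (2 * N + 2) * 4) * (N : ℝ) ^ (2 * N + 2) * Real.exp (2 * γ) := by
        rw [mul_pow]; ring
    _ ≤ _ := by gcongr
end

section
/- Let n ≥ 3 be an odd integer and set m = (n−3)/2. Let 0 < ε < 1 and let s be a real number with m ≤ s ≤ m + 1 − ε. Then for all r ≥ 0 and all η ∈ ℝⁿ, ∫_{S^{n-1}} (1 + |rθ − η|²)^{-s} dσ(θ) ≤ (2^{m+1} c_{n-2} / ε) (1 + r²)^{-s}, where σ is the surface measure on the unit sphere S^{n-1} ⊂ ℝⁿ and c_{n-2} is the total surface measure of the unit sphere S^{n-2} ⊂ ℝ^{n-1}. -/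
open MeasureTheory Metric

section helpers
open Set
open scoped ENNReal

lemma polar_lintegral {E : Type*} [NormedAddCommGroup E] [NormedSpace ℝ E] [Nontrivial E]
    [FiniteDimensional ℝ E] [MeasurableSpace E] [BorelSpace E] (μ : Measure E)
    [μ.IsAddHaarMeasure] (H : E → ℝ≥0∞) (g : sphere (0 : E) 1 → ℝ≥0∞) (F : ℝ → ℝ≥0∞)
    (hg : Measurable g) (hF : Measurable F)
    (h : ∀ r : ℝ, 0 < r → ∀ θ : sphere (0 : E) 1, H (r • (θ : E)) = g θ * F r) :
    ∫⁻ x, H x ∂μ = (∫⁻ θ, g θ ∂μ.toSphere) *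
      ∫⁻ r in Ioi (0 : ℝ), ENNReal.ofReal (r ^ (Module.finrank ℝ E - 1)) * F r := by
  calc
    ∫⁻ x, H x ∂μ = ∫⁻ x : ({(0)}ᶜ : Set E), H x.1 ∂(μ.comap (↑)) := by
      rw [lintegral_subtype_comap (measurableSet_singleton _).compl H,
        restrict_compl_singleton]
    _ = ∫⁻ x, g x.1 * F x.2 ∂μ.toSphere.prod (.volumeIoiPow (Module.finrank ℝ E - 1)) := by
      rw [← μ.measurePreserving_homeomorphUnitSphereProd.lintegral_comp_emb
        (Homeomorph.measurableEmbedding _)]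
      refine lintegral_congr fun x => ?_
      rw [← h _ (homeomorphUnitSphereProd E x).2.2]
      congr 1
      have hx : ‖(x : E)‖ ≠ 0 := norm_ne_zero_iff.2 x.2
      simp [smul_smul, hx]
    _ = _ := by
      rw [lintegral_prod_mul (g := fun x : Ioi (0 : ℝ) => F x) hg.aemeasurable (by fun_prop)]
      congr 1
      rw [Measure.volumeIoiPow, lintegral_withDensity_eq_lintegral_mul _ (by fun_prop) (by fun_prop)]
      exact lintegral_subtype_comap measurableSet_Ioi
        (fun a : ℝ => ENNReal.ofReal (a ^ (Module.finrank ℝ E - 1)) * F a)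

lemma plane_lintegral (k : ℕ) (F G : ℝ → ℝ≥0∞) (hF : Measurable F) (hG : Measurable G) :
    ∫⁻ x : ℝ, ∫⁻ ρ in Ioi (0:ℝ), ENNReal.ofReal (ρ ^ k) *
        (F (√(x ^ 2 + ρ ^ 2)) * G (x / √(x ^ 2 + ρ ^ 2))) =
      (∫⁻ φ in Ioo 0 Real.pi, ENNReal.ofReal (Real.sin φ ^ k) * G (Real.cos φ)) *
      ∫⁻ r in Ioi (0 : ℝ), ENNReal.ofReal (r ^ (k + 1)) * F r := by
  have h1 : ∀ x : ℝ, ∫⁻ ρ in Ioi (0:ℝ), ENNReal.ofReal (ρ ^ k) *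
        (F (√(x ^ 2 + ρ ^ 2)) * G (x / √(x ^ 2 + ρ ^ 2))) =
      ∫⁻ ρ : ℝ, (Ioi (0:ℝ)).indicator (fun ρ => ENNReal.ofReal (ρ ^ k) *
        (F (√(x ^ 2 + ρ ^ 2)) * G (x / √(x ^ 2 + ρ ^ 2)))) ρ := fun x => by
    rw [lintegral_indicator measurableSet_Ioi]
  simp_rw [h1]
  let f : ℝ × ℝ → ℝ≥0∞ := fun p => (Ioi (0:ℝ)).indicator (fun ρ => ENNReal.ofReal (ρ ^ k) *
        (F (√(p.1 ^ 2 + ρ ^ 2)) * G (p.1 / √(p.1 ^ 2 + ρ ^ 2)))) p.2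
  have hf : Measurable f := by
    have : f = (Prod.snd ⁻¹' Ioi (0:ℝ)).indicator (fun p : ℝ × ℝ => ENNReal.ofReal (p.2 ^ k) *
        (F (√(p.1 ^ 2 + p.2 ^ 2)) * G (p.1 / √(p.1 ^ 2 + p.2 ^ 2)))) := by
      ext p; simp [f, indicator]
    rw [this]
    exact Measurable.indicator (by fun_prop) (measurable_snd measurableSet_Ioi)
  have h2 := lintegral_prod (μ := volume) (ν := volume) f hf.aemeasurable
  change ∫⁻ x : ℝ, ∫⁻ ρ : ℝ, f (x, ρ) = _
  rw [← h2, ← Measure.volume_eq_prod, ← lintegral_comp_polarCoord_symm, mul_comm,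
    ← lintegral_indicator measurableSet_Ioi, ← lintegral_indicator measurableSet_Ioo,
    ← lintegral_prod_mul (Measurable.aemeasurable (Measurable.indicator (by fun_prop) measurableSet_Ioi))
     (Measurable.aemeasurable (Measurable.indicator (by fun_prop) measurableSet_Ioo)),
    ← Measure.volume_eq_prod,
    ← lintegral_indicator polarCoord.open_target.measurableSet]
  refine lintegral_congr fun p => ?_
  obtain ⟨r, φ⟩ := p
  simp only [indicator, polarCoord_target, mem_prod, mem_Ioi, mem_Ioo, f, polarCoord_symm_apply]
  by_cases hr : 0 < r
  swap
  · simp [hr]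
  have hs : √((r * Real.cos φ) ^ 2 + (r * Real.sin φ) ^ 2) = r := by
    rw [show (r * Real.cos φ) ^ 2 + (r * Real.sin φ) ^ 2 = r ^ 2 by
      linear_combination r ^ 2 * Real.sin_sq_add_cos_sq φ]
    exact Real.sqrt_sq hr.le
  by_cases hφ : 0 < φ ∧ φ < Real.pi
  · have hsin := Real.sin_pos_of_pos_of_lt_pi hφ.1 hφ.2
    rw [if_pos ⟨hr, by linarith [hφ.1, Real.pi_pos], hφ.2⟩, if_pos (by positivity), if_pos hr,
      if_pos hφ, hs, mul_div_cancel_left₀ _ hr.ne', mul_pow, ENNReal.ofReal_mul (by positivity),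
      pow_succ, ENNReal.ofReal_mul (by positivity), smul_eq_mul]
    ring
  · rw [if_neg hφ, mul_zero]
    split_ifs with h3 h4
    · exfalso
      apply hφ
      refine ⟨?_, h3.2.2⟩
      by_contra h5
      have := Real.sin_nonpos_of_nonpos_of_neg_pi_le (not_lt.1 h5) h3.2.1.le
      nlinarith
    · simp
    · rfl

lemma slice_lintegral (d : ℕ) (hd : 1 ≤ d) (e : EuclideanSpace ℝ (Fin (d + 1))) (he : ‖e‖ = 1)
    (G : ℝ → ℝ≥0∞) (hG : Measurable G) :
    ∫⁻ θ : sphere (0 : EuclideanSpace ℝ (Fin (d + 1))) 1, G (inner ℝ e (θ : EuclideanSpace ℝ (Fin (d + 1))))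
      ∂((volume : Measure (EuclideanSpace ℝ (Fin (d + 1)))).toSphere) =
    ((volume : Measure (EuclideanSpace ℝ (Fin d))).toSphere univ) *
      ∫⁻ φ in Ioo 0 Real.pi, ENNReal.ofReal (Real.sin φ ^ (d - 1)) * G (Real.cos φ) := by
  have : Nonempty (Fin d) := ⟨⟨0, hd⟩⟩
  set F : ℝ → ℝ≥0∞ := (Iio (1:ℝ)).indicator 1 with hFdef
  have hF : Measurable F := measurable_one.indicator measurableSet_Iio
  set K := ∫⁻ r in Ioi (0 : ℝ), ENNReal.ofReal (r ^ d) * F r with hK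
  have hK' : K = ENNReal.ofReal (1 / (d + 1)) := by
    have := Measure.volumeIoiPow_apply_Iio d ⟨1, mem_Ioi.2 one_pos⟩
    rw [one_pow] at this
    rw [← this, ← lintegral_indicator_one measurableSet_Iio, Measure.volumeIoiPow,
      lintegral_withDensity_eq_lintegral_mul _ (by fun_prop) 
       (measurable_one.indicator measurableSet_Iio)]
    symm
    rw [hK, ← lintegral_subtype_comap measurableSet_Ioi]
    refine lintegral_congr fun x => ?_
    simp only [Pi.mul_apply, F, indicator]
    rfl
  have hK0 : K ≠ 0 := by rw [hK']; simp; positivity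
  have hKt : K ≠ ∞ := by rw [hK']; simp
  obtain ⟨b, hb⟩ := Orthonormal.exists_orthonormalBasis_extension_of_card_eq (𝕜 := ℝ)
    (E := EuclideanSpace ℝ (Fin (d + 1))) (ι := Fin (d + 1)) (by simp) (v := fun _ => e) (s := {0})
    ⟨fun i => he, fun i j hij => (hij (Subsingleton.elim _ _)).elim⟩
  have hb0 : b 0 = e := hb 0 rfl
  let H : EuclideanSpace ℝ (Fin (d + 1)) → ℝ≥0∞ := fun x => G (inner ℝ e x / ‖x‖) * F ‖x‖
  have hH : Measurable H := by
    have : Measurable fun x => inner ℝ e x := (continuous_const.inner continuous_id).measurable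
    fun_prop
  have e1 := polar_lintegral (volume : Measure (EuclideanSpace ℝ (Fin (d + 1)))) H
    (fun θ => G (inner ℝ e (θ : EuclideanSpace ℝ (Fin (d + 1))))) F 
    (hG.comp (continuous_const.inner continuous_subtype_val).measurable) hF (by
      intro r hr θ
      have : ‖(θ : EuclideanSpace ℝ (Fin (d + 1)))‖ = 1 := by simp
      simp only [H, norm_smul, this, inner_smul_right, Real.norm_eq_abs, abs_of_pos hr, mul_one]
      rw [mul_div_cancel_left₀ _ hr.ne'])
  rw [finrank_euclideanSpace_fin, Nat.add_sub_cancel, ← hK] at e1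
  have e2 : ∫⁻ x, H x = ∫⁻ x : ℝ, ∫⁻ y : EuclideanSpace ℝ (Fin d),
      (F (√(x ^ 2 + ‖y‖ ^ 2)) * G (x / √(x ^ 2 + ‖y‖ ^ 2))) := by
    let Q' : ℝ × (Fin d → ℝ) → ℝ≥0∞ := fun p =>
      F (√(p.1 ^ 2 + ∑ i, p.2 i ^ 2)) * G (p.1 / √(p.1 ^ 2 + ∑ i, p.2 i ^ 2))
    have hQ' : Measurable Q' := by fun_prop
    have f1 : ∀ a : EuclideanSpace ℝ (Fin (d + 1)), H (b.repr.symm a) =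
        Q' (MeasurableEquiv.piFinSuccAbove (fun _ : Fin (d+1) => ℝ) 0 (WithLp.ofLp a)) := by
      intro a
      have g1 : inner ℝ e (b.repr.symm a) = a 0 := by
        rw [← hb0, ← b.repr_apply_apply]; simp
      have g2 : ‖a‖ = √(a 0 ^ 2 + ∑ i : Fin d, a i.succ ^ 2) := by
        rw [EuclideanSpace.norm_eq, Fin.sum_univ_succ]; simp
      simp only [H, g1, LinearIsometryEquiv.norm_map, Q', g2]
      rw [mul_comm]
      rfl
    rw [← b.measurePreserving_repr_symm.lintegral_comp hH, lintegral_congr f1,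
      (PiLp.volume_preserving_ofLp (Fin (d+1))).lintegral_comp
        (f := fun z => Q' (MeasurableEquiv.piFinSuccAbove (fun _ : Fin (d+1) => ℝ) 0 z))
        (hQ'.comp (MeasurableEquiv.measurable _)),
      (volume_preserving_piFinSuccAbove (fun _ : Fin (d+1) => ℝ) 0).lintegral_comp hQ',
      Measure.volume_eq_prod, lintegral_prod _ hQ'.aemeasurable]
    refine lintegral_congr fun x => ?_
    rw [← (PiLp.volume_preserving_ofLp (Fin d)).lintegral_comp (by fun_prop)]
    refine lintegral_congr fun y => ?_
    simp [Q', EuclideanSpace.norm_sq_eq]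
  have e3 : ∀ x : ℝ, ∫⁻ y : EuclideanSpace ℝ (Fin d),
      (F (√(x ^ 2 + ‖y‖ ^ 2)) * G (x / √(x ^ 2 + ‖y‖ ^ 2))) = 
      ((volume : Measure (EuclideanSpace ℝ (Fin d))).toSphere univ) * 
       ∫⁻ ρ in Ioi (0:ℝ), ENNReal.ofReal (ρ ^ (d-1)) *
        (F (√(x ^ 2 + ρ ^ 2)) * G (x / √(x ^ 2 + ρ ^ 2))) := fun x => by
    rw [polar_lintegral volume _ (fun _ => 1) (fun ρ => F (√(x ^ 2 + ρ ^ 2)) * G (x / √(x ^ 2 + ρ ^ 2)))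
      measurable_const (by fun_prop)]
    · simp
    · intro r hr θ
      simp [norm_smul]
  simp_rw [e3] at e2
  rw [lintegral_const_mul' _ _ (measure_ne_top _ _), plane_lintegral _ _ _ hF hG,
    Nat.sub_add_cancel hd, ← hK, e1, ← mul_assoc] at e2
  exact (ENNReal.mul_left_inj hK0 hKt).1 e2

lemma ftc_lintegral {a b : ℝ} (hab : a ≤ b) (f f' : ℝ → ℝ) (hf : ContinuousOn f (Icc a b))
    (hd : ∀ x ∈ Ioo a b, HasDerivAt f (f' x) x) (hpos : ∀ x ∈ Ioo a b, 0 ≤ f' x) :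
    ∫⁻ x in Ioo a b, ENNReal.ofReal (f' x) = ENNReal.ofReal (f b - f a) := by
  have hi := intervalIntegral.integrableOn_deriv_of_nonneg hf hd hpos
  rw [← intervalIntegral.integral_eq_sub_of_hasDerivAt_of_le hab hf hd
    ((intervalIntegrable_iff_integrableOn_Ioc_of_le hab).2 hi),
    intervalIntegral.integral_of_le hab, integral_Ioc_eq_integral_Ioo,
    ofReal_integral_eq_lintegral_ofReal (hi.mono_set Ioo_subset_Ioc_self)]
  exact (ae_restrict_iff' measurableSet_Ioo).2 (.of_forall hpos)

lemma angular_bound (m : ℕ) (ε : ℝ) (hε : 0 < ε) (hε1 : ε < 1)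
    (s : ℝ) (hs : (m : ℝ) ≤ s) (hs' : s ≤ (m : ℝ) + 1 - ε) (r ρ : ℝ) (hr : 0 ≤ r) (hρ : 0 ≤ ρ) :
    ∫⁻ φ in Ioo 0 Real.pi, ENNReal.ofReal (Real.sin φ ^ (2 * m + 1)) *
      ENNReal.ofReal ((1 + (r ^ 2 + ρ ^ 2 - 2 * r * ρ * Real.cos φ)) ^ (-s)) ≤
      ENNReal.ofReal (2 / ε * (1 + r ^ 2) ^ (-s)) := by
  have hpi := Real.pi_pos
  have hC : 0 < 1 + r ^ 2 := by positivity
  have hs0 : 0 ≤ s := le_trans (Nat.cast_nonneg m) hs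
  set D := (1 + r ^ 2) ^ (-s) with hD
  have hD0 : 0 < D := Real.rpow_pos_of_pos hC _
  have hu : 0 < (m : ℝ) - s + 1 := by linarith
  have h1 : ∫⁻ φ in Ioo 0 (Real.pi / 2), ENNReal.ofReal (Real.sin φ ^ (2 * m + 1)) *
      ENNReal.ofReal ((1 + (r ^ 2 + ρ ^ 2 - 2 * r * ρ * Real.cos φ)) ^ (-s)) ≤
      ENNReal.ofReal (D / ((m : ℝ) - s + 1)) := by
    have key := ftc_lintegral (a := 0) (b := Real.pi / 2) (by positivity)
      (fun φ => D * ((1 - Real.cos φ) ^ ((m : ℝ) - s + 1) / ((m : ℝ) - s + 1)))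
      (fun φ => D * (Real.sin φ * (1 - Real.cos φ) ^ ((m : ℝ) - s)))
      (by
        refine ContinuousOn.mul continuousOn_const (ContinuousOn.div_const ?_ _)
        refine ContinuousOn.rpow_const (by fun_prop) fun x _ => Or.inr hu.le)
      (by
        intro x hx
        have hc : 0 < 1 - Real.cos x := by
          have := Real.cos_lt_cos_of_nonneg_of_le_pi le_rfl (by linarith [hx.2]) hx.1
          simp at this; linarith
        have := (((Real.hasDerivAt_cos x).const_sub 1).rpow_const (p := (m : ℝ) - s + 1)
          (Or.inl hc.ne')).div_const ((m : ℝ) - s + 1)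
        have := this.const_mul D
        convert! this using 1
        rw [add_sub_cancel_right]
        field_simp)
      (by
        intro x hx
        have := Real.sin_pos_of_pos_of_lt_pi hx.1 (by linarith [hx.2])
        have := Real.cos_le_one x
        exact mul_nonneg hD0.le (mul_nonneg (le_of_lt (by assumption)) (Real.rpow_nonneg (by linarith) _)))
    have e0 : D / ((m : ℝ) - s + 1) = D * ((1 - Real.cos (Real.pi / 2)) ^ ((m : ℝ) - s + 1) / ((m : ℝ) - s + 1))
      - D * ((1 - Real.cos 0) ^ ((m : ℝ) - s + 1) / ((m : ℝ) - s + 1)) := by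
      simp [Real.zero_rpow hu.ne']; ring
    rw [e0, ← key]
    refine setLIntegral_mono' measurableSet_Ioo fun x hx => ?_
    have hsin := Real.sin_pos_of_pos_of_lt_pi hx.1 (by linarith [hx.2])
    have hcos := Real.cos_pos_of_mem_Ioo ⟨by linarith [hx.1], hx.2⟩
    have hsc := Real.sin_sq_add_cos_sq x
    have hc1 : 0 < 1 - Real.cos x := by nlinarith
    rw [← ENNReal.ofReal_mul (by positivity)]
    apply ENNReal.ofReal_le_ofReal
    have i1 : (1 + (r ^ 2 + ρ ^ 2 - 2 * r * ρ * Real.cos x)) ^ (-s) ≤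
        ((1 + r ^ 2) * Real.sin x ^ 2) ^ (-s) := by
      apply Real.rpow_le_rpow_of_nonpos (by positivity) _ (by linarith)
      rw [show Real.sin x ^ 2 = 1 - Real.cos x ^ 2 by linarith]
      nlinarith [sq_nonneg (ρ - r * Real.cos x), sq_nonneg (Real.cos x)]
    rw [Real.mul_rpow hC.le (by positivity), ← hD] at i1
    have i2 : (Real.sin x ^ 2) ^ ((m : ℝ) - s) ≤ (1 - Real.cos x) ^ ((m : ℝ) - s) := by
      apply Real.rpow_le_rpow_of_nonpos hc1 _ (by linarith)
      nlinarith
    have i3 : (Real.sin x ^ 2) ^ ((m : ℝ) - s) = Real.sin x ^ (2 * m) * (Real.sin x ^ 2) ^ (-s) := by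
      rw [sub_eq_add_neg, Real.rpow_add (by positivity), Real.rpow_natCast, pow_mul]
    calc Real.sin x ^ (2 * m + 1) * (1 + (r ^ 2 + ρ ^ 2 - 2 * r * ρ * Real.cos x)) ^ (-s)
        ≤ Real.sin x ^ (2 * m + 1) * (D * (Real.sin x ^ 2) ^ (-s)) := by gcongr
      _ = D * (Real.sin x * (Real.sin x ^ 2) ^ ((m : ℝ) - s)) := by rw [i3]; ring
      _ ≤ _ := by gcongr
  have h2 : ∫⁻ φ in Ioo (Real.pi / 2) Real.pi, ENNReal.ofReal (Real.sin φ ^ (2 * m + 1)) *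
      ENNReal.ofReal ((1 + (r ^ 2 + ρ ^ 2 - 2 * r * ρ * Real.cos φ)) ^ (-s)) ≤
      ENNReal.ofReal D := by
    have key := ftc_lintegral (a := Real.pi / 2) (b := Real.pi) (by linarith)
      (fun φ => D * (- Real.cos φ)) (fun φ => D * Real.sin φ) (by fun_prop)
      (by
        intro x hx
        simpa using ((Real.hasDerivAt_cos x).neg).const_mul D)
      (by
        intro x hx
        have := Real.sin_pos_of_pos_of_lt_pi (by linarith [hx.1]) hx.2
        positivity)
    have e0 : D = D * (- Real.cos Real.pi) - D * (- Real.cos (Real.pi / 2)) := by simp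
    rw [e0, ← key]
    refine setLIntegral_mono' measurableSet_Ioo fun x hx => ?_
    have hsin := Real.sin_pos_of_pos_of_lt_pi (by linarith [hx.1]) hx.2
    have hcos := Real.cos_nonpos_of_pi_div_two_le_of_le hx.1.le (by linarith [hx.2])
    rw [← ENNReal.ofReal_mul (by positivity)]
    apply ENNReal.ofReal_le_ofReal
    have i1 : (1 + (r ^ 2 + ρ ^ 2 - 2 * r * ρ * Real.cos x)) ^ (-s) ≤ D := by
      apply Real.rpow_le_rpow_of_nonpos hC _ (by linarith)
      nlinarith [mul_nonneg (mul_nonneg hr hρ) (neg_nonneg.2 hcos), sq_nonneg ρ]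
    have i2 : Real.sin x ^ (2 * m + 1) ≤ Real.sin x :=
      pow_le_of_le_one hsin.le (Real.sin_le_one x) (by omega)
    rw [mul_comm]
    gcongr
  rw [← Ioo_union_Ico_eq_Ioo (show (0:ℝ) < Real.pi / 2 by positivity) (show Real.pi / 2 ≤ Real.pi by linarith)]
  refine (lintegral_union_le _ _ _).trans ?_
  rw [Measure.restrict_congr_set (Ioo_ae_eq_Ico (a := Real.pi / 2) (b := Real.pi)).symm]
  refine (add_le_add h1 h2).trans ?_
  rw [← ENNReal.ofReal_add (by positivity) hD0.le]
  apply ENNReal.ofReal_le_ofReal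
  have j1 : D / ((m : ℝ) - s + 1) ≤ D / ε := by gcongr; linarith
  have j2 : D ≤ D / ε := by rw [le_div_iff₀ hε]; nlinarith
  calc _ ≤ D / ε + D / ε := add_le_add j1 j2
    _ = _ := by ring

end helpers

theorem stmt_11 (n m : ℕ) (hn : n = 2 * m + 3)
    (ε : ℝ) (hε : 0 < ε) (hε1 : ε < 1)
    (s : ℝ) (hs : (m : ℝ) ≤ s) (hs' : s ≤ (m : ℝ) + 1 - ε)
    (r : ℝ) (hr : 0 ≤ r) (η : EuclideanSpace ℝ (Fin n)) :
    ∫ θ : sphere (0 : EuclideanSpace ℝ (Fin n)) 1,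
        (1 + ‖r • (θ : EuclideanSpace ℝ (Fin n)) - η‖ ^ 2) ^ (-s)
        ∂((volume : Measure (EuclideanSpace ℝ (Fin n))).toSphere) ≤
      (2 ^ (m + 1) *
          (((volume : Measure (EuclideanSpace ℝ (Fin (n - 1)))).toSphere Set.univ).toReal) / ε) *
        (1 + r ^ 2) ^ (-s) := by
  subst hn
  change _ ≤ (2 ^ (m + 1) *
    (((volume : Measure (EuclideanSpace ℝ (Fin (2 * m + 2)))).toSphere Set.univ).toReal) / ε) *
        (1 + r ^ 2) ^ (-s)
  obtain ⟨e, he, hη⟩ : ∃ e : EuclideanSpace ℝ (Fin (2 * m + 3)), ‖e‖ = 1 ∧ η = ‖η‖ • e := by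
    by_cases h0 : η = 0
    · exact ⟨EuclideanSpace.single 0 1, by simp, by simp [h0]⟩
    · have : ‖η‖ ≠ 0 := norm_ne_zero_iff.2 h0
      refine ⟨‖η‖⁻¹ • η, by simp [norm_smul, this], by simp [smul_smul, this]⟩
  have hsl := slice_lintegral (2 * m + 2) (by omega) e he
    (fun t => ENNReal.ofReal ((1 + (r ^ 2 + ‖η‖ ^ 2 - 2 * r * ‖η‖ * t)) ^ (-s))) (by fun_prop)
  have hb := angular_bound m ε hε hε1 s hs hs' r ‖η‖ hr (norm_nonneg _)
  have hpt : ∀ θ : sphere (0 : EuclideanSpace ℝ (Fin (2 * m + 3))) 1,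
      ‖r • (θ : EuclideanSpace ℝ (Fin (2 * m + 3))) - η‖ ^ 2 =
      r ^ 2 + ‖η‖ ^ 2 - 2 * r * ‖η‖ * inner ℝ e (θ : EuclideanSpace ℝ (Fin (2 * m + 3))) := by
    intro θ
    have h1 : ‖(θ : EuclideanSpace ℝ (Fin (2 * m + 3)))‖ = 1 := by simp
    have h2 : inner ℝ (θ : EuclideanSpace ℝ (Fin (2 * m + 3))) η =
        ‖η‖ * inner ℝ e (θ : EuclideanSpace ℝ (Fin (2 * m + 3))) := by
      conv_lhs => rw [hη]
      rw [inner_smul_right, real_inner_comm]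
    rw [norm_sub_sq_real, norm_smul, h1, real_inner_smul_left, h2, Real.norm_eq_abs, mul_one,
      sq_abs]
    ring
  rw [integral_eq_lintegral_of_nonneg_ae
    (.of_forall fun θ => Real.rpow_nonneg (by positivity) _)
    (Continuous.aestronglyMeasurable (by
      refine Continuous.rpow_const (by fun_prop) fun x => Or.inl (by positivity)))]
  simp_rw [hpt]
  rw [hsl]
  refine ENNReal.toReal_le_of_le_ofReal (by positivity) ?_
  set c := (volume : Measure (EuclideanSpace ℝ (Fin (2 * m + 2)))).toSphere Set.univ
  have hc : c ≠ ⊤ := measure_ne_top _ _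
  calc _ ≤ c * ENNReal.ofReal (2 / ε * (1 + r ^ 2) ^ (-s)) := mul_le_mul_right hb _
    _ = ENNReal.ofReal (c.toReal * (2 / ε * (1 + r ^ 2) ^ (-s))) := by
      rw [ENNReal.ofReal_mul ENNReal.toReal_nonneg, ENNReal.ofReal_toReal hc]
    _ ≤ _ := by
      apply ENNReal.ofReal_le_ofReal
      have h2 : (2 : ℝ) ≤ 2 ^ (m + 1) := le_self_pow₀ (by norm_num) (by omega)
      calc c.toReal * (2 / ε * (1 + r ^ 2) ^ (-s)) = (2 * c.toReal / ε) * (1 + r ^ 2) ^ (-s) := by ring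
        _ ≤ _ := by gcongr
end

section
/- Let n ≥ 3 be an odd integer and set m = (n−3)/2. Let s be a real number with m ≤ s ≤ m + 1. Then for all ρ ≥ 0 and γ > 0, ∫₀^∞ h_γ(r, ρ)² r^{2m+2} (1 + r²)^{-s} dr ≤ 8 γ^{-1} (1 + ρ²)^{-(s−m)}. -/
open MeasureTheory

/-- `hfun γ r s = (γ + |r-s|)⁻¹ (γ + |r+s|)⁻¹`. -/
noncomputable def hfun (γ r s : ℝ) : ℝ := (γ + |r - s|)⁻¹ * (γ + |r + s|)⁻¹

theorem aux_Ioi (γ : ℝ) (hγ : 0 < γ) :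
    ∫ x in Set.Ioi (0 : ℝ), ((γ + x)⁻¹) ^ 2 = γ⁻¹ := by
  have h := integral_Ioi_of_hasDerivAt_of_nonneg' (a := 0) (l := 0)
    (g := fun x : ℝ => -(γ + x)⁻¹) (g' := fun x => ((γ + x)⁻¹) ^ 2) ?_ ?_ ?_
  · simpa using h
  · intro x hx
    have hx : (0:ℝ) ≤ x := hx
    have h1 : γ + x ≠ 0 := by positivity
    have := (((hasDerivAt_id x).const_add γ).inv h1).neg
    refine this.congr_deriv ?_
    simp only [id]
    field_simp
  · intro x _
    positivity
  · have : Filter.Tendsto (fun x : ℝ => γ + x) Filter.atTop Filter.atTop :=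
      Filter.tendsto_atTop_add_const_left _ _ Filter.tendsto_id
    simpa using (tendsto_inv_atTop_zero.comp this).neg

theorem aux_full (γ ρ : ℝ) (hγ : 0 < γ) :
    ∫ x : ℝ, ((γ + |x - ρ|)⁻¹) ^ 2 = 2 * γ⁻¹ := by
  rw [integral_sub_right_eq_self (fun x : ℝ => ((γ + |x|)⁻¹) ^ 2) ρ,
    integral_comp_abs (f := fun x : ℝ => ((γ + x)⁻¹) ^ 2), aux_Ioi γ hγ]

theorem aux_int_s12 (γ ρ : ℝ) (hγ : 0 < γ) :
    Integrable (fun x : ℝ => ((γ + |x - ρ|)⁻¹) ^ 2) := by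
  by_contra h
  have h1 := aux_full γ ρ hγ
  rw [integral_undef h] at h1
  have : 0 < γ⁻¹ := by positivity
  linarith

theorem aux_key (r ρ σ : ℝ) (hr : 0 < r) (hρ : 0 ≤ ρ) (h0 : 0 ≤ σ) (h1 : σ ≤ 1) :
    r ^ 2 * (1 + r ^ 2) ^ (-σ) ≤ (r + ρ) ^ 2 * (1 + ρ ^ 2) ^ (-σ) := by
  have hR : 0 < 1 + r ^ 2 := by positivity
  have hP : 0 < 1 + ρ ^ 2 := by positivity
  rcases le_total ρ r with h | h
  · have : (1 + r ^ 2) ^ (-σ) ≤ (1 + ρ ^ 2) ^ (-σ) :=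
      Real.rpow_le_rpow_of_nonpos hP (by gcongr) (by linarith)
    have h2 : r ^ 2 ≤ (r + ρ) ^ 2 := by gcongr; linarith
    gcongr
  · have e : ((1 + ρ ^ 2) / (1 + r ^ 2)) ^ σ ≤ (1 + ρ ^ 2) / (1 + r ^ 2) := by
      have : 1 ≤ (1 + ρ ^ 2) / (1 + r ^ 2) := by
        rw [one_le_div hR]; gcongr
      simpa using Real.rpow_le_rpow_of_exponent_le this h1
    have e2 : r ^ 2 * ((1 + ρ ^ 2) / (1 + r ^ 2)) ≤ (r + ρ) ^ 2 := by
      rw [← mul_div_assoc, div_le_iff₀ hR]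
      have : r ^ 2 ≤ ρ ^ 2 := by gcongr
      have : 0 ≤ r * ρ := by positivity
      nlinarith [mul_nonneg this hR.le, sq_nonneg r, mul_nonneg (sq_nonneg r) (sq_nonneg r)]
    have e3 : r ^ 2 * ((1 + ρ ^ 2) / (1 + r ^ 2)) ^ σ ≤ (r + ρ) ^ 2 :=
      (mul_le_mul_of_nonneg_left e (sq_nonneg r)).trans e2
    have e4 : (1 + r ^ 2) ^ (-σ) = ((1 + ρ ^ 2) / (1 + r ^ 2)) ^ σ * (1 + ρ ^ 2) ^ (-σ) := by
      rw [Real.div_rpow hP.le hR.le, Real.rpow_neg hR.le, Real.rpow_neg hP.le]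
      have := (Real.rpow_pos_of_pos hP σ).ne'
      field_simp
    rw [e4, ← mul_assoc]
    gcongr

theorem aux_pt (m : ℕ) (s : ℝ) (hs : (m : ℝ) ≤ s) (hs' : s ≤ (m : ℝ) + 1)
    (ρ : ℝ) (hρ : 0 ≤ ρ) (γ : ℝ) (hγ : 0 < γ) (r : ℝ) (hr : 0 < r) :
    hfun γ r ρ ^ 2 * r ^ (2 * m + 2) * (1 + r ^ 2) ^ (-s) ≤
      ((γ + |r - ρ|)⁻¹) ^ 2 * (1 + ρ ^ 2) ^ (-(s - (m : ℝ))) := by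
  have hR : 0 < 1 + r ^ 2 := by positivity
  have key := aux_key r ρ (s - m) hr hρ (by linarith) (by linarith)
  have e1 : (1 + r ^ 2) ^ (-s) = (1 + r ^ 2) ^ (-(s - (m:ℝ))) * ((1 + r ^ 2) ^ m)⁻¹ := by
    rw [← Real.rpow_natCast (1 + r ^ 2) m, ← Real.rpow_neg hR.le, ← Real.rpow_add hR]
    congr 1; ring
  have e2 : (r ^ 2) ^ m * ((1 + r ^ 2) ^ m)⁻¹ ≤ 1 := by
    rw [← div_eq_mul_inv, div_le_one (by positivity)]
    gcongr; linarith
  have e3 : r ^ (2 * m + 2) * (1 + r ^ 2) ^ (-s) ≤ (r + ρ) ^ 2 * (1 + ρ ^ 2) ^ (-(s - (m:ℝ))) := by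
    calc _ = (r ^ 2 * (1 + r ^ 2) ^ (-(s - (m:ℝ)))) * ((r ^ 2) ^ m * ((1 + r ^ 2) ^ m)⁻¹) := by
          rw [e1, ← pow_mul]; ring
      _ ≤ (r ^ 2 * (1 + r ^ 2) ^ (-(s - (m:ℝ)))) * 1 := by gcongr
      _ ≤ _ := by rw [mul_one]; exact key
  have e4 : ((γ + |r + ρ|)⁻¹) ^ 2 * (r + ρ) ^ 2 ≤ 1 := by
    rw [← mul_pow, abs_of_nonneg (by positivity : 0 ≤ r + ρ)]
    apply pow_le_one₀ (by positivity)
    rw [inv_mul_le_one₀ (by positivity)]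
    linarith
  have hP : 0 ≤ (1 + ρ ^ 2) ^ (-(s - (m:ℝ))) := by positivity
  calc _ = ((γ + |r - ρ|)⁻¹) ^ 2 * ((γ + |r + ρ|)⁻¹) ^ 2 *
          (r ^ (2 * m + 2) * (1 + r ^ 2) ^ (-s)) := by unfold hfun; ring
    _ ≤ ((γ + |r - ρ|)⁻¹) ^ 2 * ((γ + |r + ρ|)⁻¹) ^ 2 *
          ((r + ρ) ^ 2 * (1 + ρ ^ 2) ^ (-(s - (m:ℝ)))) := by gcongr
    _ = ((γ + |r - ρ|)⁻¹) ^ 2 * (1 + ρ ^ 2) ^ (-(s - (m:ℝ))) *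
          (((γ + |r + ρ|)⁻¹) ^ 2 * (r + ρ) ^ 2) := by ring
    _ ≤ ((γ + |r - ρ|)⁻¹) ^ 2 * (1 + ρ ^ 2) ^ (-(s - (m:ℝ))) * 1 := by gcongr
    _ = _ := mul_one _

theorem stmt_12 (n m : ℕ) (hn : n = 2 * m + 3)
    (s : ℝ) (hs : (m : ℝ) ≤ s) (hs' : s ≤ (m : ℝ) + 1)
    (ρ : ℝ) (hρ : 0 ≤ ρ) (γ : ℝ) (hγ : 0 < γ) :
    ∫ r in Set.Ioi (0 : ℝ), hfun γ r ρ ^ 2 * r ^ (2 * m + 2) * (1 + r ^ 2) ^ (-s) ≤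
      8 * γ⁻¹ * (1 + ρ ^ 2) ^ (-(s - (m : ℝ))) := by
  have hint := (aux_int_s12 γ ρ hγ)
  have hP : 0 ≤ (1 + ρ ^ 2) ^ (-(s - (m:ℝ))) := by positivity
  calc _ ≤ ∫ r in Set.Ioi (0 : ℝ), ((γ + |r - ρ|)⁻¹) ^ 2 * (1 + ρ ^ 2) ^ (-(s - (m : ℝ))) := by
        apply integral_mono_of_nonneg
        · filter_upwards [ae_restrict_mem measurableSet_Ioi] with r hr
          have hr : 0 < r := hr
          simp only [Pi.zero_apply]
          positivity
        · exact hint.integrableOn.mul_const _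
        · filter_upwards [ae_restrict_mem measurableSet_Ioi] with r hr
          exact aux_pt m s hs hs' ρ hρ γ hγ r hr
    _ = (∫ r in Set.Ioi (0 : ℝ), ((γ + |r - ρ|)⁻¹) ^ 2) * (1 + ρ ^ 2) ^ (-(s - (m : ℝ))) :=
        integral_mul_const _ _
    _ ≤ (∫ r : ℝ, ((γ + |r - ρ|)⁻¹) ^ 2) * (1 + ρ ^ 2) ^ (-(s - (m : ℝ))) := by
        apply mul_le_mul_of_nonneg_right _ hP
        exact setIntegral_le_integral hint (Filter.Eventually.of_forall fun r => sq_nonneg _)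
    _ ≤ _ := by
        rw [aux_full γ ρ hγ]
        gcongr
        norm_num
end

section
/- Let n ≥ 3 be an odd integer, set m = (n−3)/2, and let 0 < ε < 1. Then there is a constant C = C(n, ε) such that for every real s with m ≤ s ≤ m + 1 − ε, every η ∈ ℝⁿ, every ρ ≥ 0 and every γ > 0, ∫_{ℝⁿ} h_γ(|ξ|, ρ)² ⟨ξ − η⟩^{-2s} dξ ≤ C γ^{-1} ⟨ρ⟩^{2m − 2s}. -/
open MeasureTheory

/-- The Japanese bracket `⟨x⟩ = (1 + |x|²)^{1/2}` of a vector. -/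
noncomputable def jap {E : Type*} [NormedAddCommGroup E] (x : E) : ℝ :=
  Real.sqrt (1 + ‖x‖ ^ 2)

/-- The Japanese bracket `⟨x⟩ = (1 + x²)^{1/2}` of a real number. -/
noncomputable def japR (x : ℝ) : ℝ := Real.sqrt (1 + x ^ 2)

open scoped ENNReal Pointwise

lemma s13_cap (m : ℕ) (ζ : EuclideanSpace ℝ (Fin (2 * m + 3))) (N : ℕ) (hN : 0 < N) :
    (volume : Measure (EuclideanSpace ℝ (Fin (2 * m + 3)))).toSphere
      {ω | ‖(ω : EuclideanSpace ℝ (Fin (2 * m + 3))) - ζ‖ ≤ 1 / N} ≤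
    (((2 * m + 3 : ℕ) : ℝ≥0∞) * (ENNReal.ofReal (2 ^ (2 * m + 3)) *
      volume (Metric.ball (0 : EuclideanSpace ℝ (Fin (2 * m + 3))) 1))) *
      ENNReal.ofReal ((1 / (N : ℝ)) ^ (2 * m + 2)) := by
  have hN' : (0 : ℝ) < N := by exact_mod_cast hN
  rw [Measure.toSphere_apply']
  swap
  · exact measurableSet_le (by fun_prop) (by fun_prop)
  rw [finrank_euclideanSpace_fin, mul_assoc]
  gcongr
  calc _ ≤ volume (⋃ j ∈ Finset.range N, Metric.closedBall (((j : ℝ) / N) • ζ) (2 / (N : ℝ))) := by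
        apply measure_mono
        rintro x hx
        obtain ⟨c, ⟨hc0, hc1⟩, y, ⟨ω, hω, rfl⟩, rfl⟩ := Set.mem_smul.1 hx
        simp only [Set.mem_ofPred_eq] at hω
        simp only [Set.mem_iUnion]
        have hω1 : ‖(ω : EuclideanSpace ℝ (Fin (2 * m + 3)))‖ = 1 := by simp
        have hcN : 0 ≤ c * N := by positivity
        have hf1 := Nat.floor_le hcN
        have hf2 := Nat.lt_floor_add_one (c * N)
        set j := ⌊c * N⌋₊ with hj
        have hjN : j < N := by
          have : (j : ℝ) < N := by nlinarith
          exact_mod_cast this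
        refine ⟨j, Finset.mem_range.2 hjN, ?_⟩
        rw [Metric.mem_closedBall, dist_eq_norm]
        have e : c • (ω : EuclideanSpace ℝ (Fin (2 * m + 3))) - ((j : ℝ) / N) • ζ =
          (c - (j : ℝ) / N) • (ω : EuclideanSpace ℝ (Fin (2 * m + 3))) +
            ((j : ℝ) / N) • ((ω : EuclideanSpace ℝ (Fin (2 * m + 3))) - ζ) := by
          module
        rw [e]
        refine (norm_add_le _ _).trans ?_
        rw [norm_smul, norm_smul, hω1, mul_one, Real.norm_eq_abs, Real.norm_eq_abs]
        have h1 : |c - (j : ℝ) / N| ≤ 1 / N := by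
          rw [abs_le]
          have : c - (j : ℝ) / N = (c * N - j) / N := by field_simp
          rw [this]
          constructor
          · have : 0 ≤ (c * N - j) / N := by apply div_nonneg <;> linarith
            have : 0 ≤ 1 / (N : ℝ) := by positivity
            linarith
          · gcongr; linarith
        have h2 : |(j : ℝ) / N| ≤ 1 := by
          rw [abs_of_nonneg (by positivity), div_le_one hN']
          exact_mod_cast hjN.le
        have h3 : |(j : ℝ) / N| * ‖(ω : EuclideanSpace ℝ (Fin (2 * m + 3))) - ζ‖ ≤ 1 * (1 / N) := by
          gcongr
        calc _ ≤ 1 / (N : ℝ) + 1 * (1 / N) := add_le_add h1 h3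
          _ = 2 / N := by ring
    _ ≤ ∑ j ∈ Finset.range N, volume (Metric.closedBall (((j : ℝ) / N) • ζ) (2 / (N : ℝ))) :=
        measure_biUnion_finset_le _ _
    _ = (N : ℝ≥0∞) * (ENNReal.ofReal ((2 / (N : ℝ)) ^ (2 * m + 3)) *
          volume (Metric.ball (0 : EuclideanSpace ℝ (Fin (2 * m + 3))) 1)) := by
        simp_rw [fun x => Measure.addHaar_closedBall
          (volume : Measure (EuclideanSpace ℝ (Fin (2 * m + 3)))) x
          (show (0 : ℝ) ≤ 2 / N by positivity), finrank_euclideanSpace_fin]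
        simp
    _ = (ENNReal.ofReal (2 ^ (2 * m + 3)) *
          volume (Metric.ball (0 : EuclideanSpace ℝ (Fin (2 * m + 3))) 1)) *
          ENNReal.ofReal ((1 / (N : ℝ)) ^ (2 * m + 2)) := by
        rw [mul_right_comm, ← mul_assoc, ← ENNReal.ofReal_natCast,
          ← ENNReal.ofReal_mul (by positivity), ← ENNReal.ofReal_mul (by positivity)]
        congr 2
        rw [div_pow, div_pow, one_pow, pow_succ (N : ℝ) (2 * m + 2)]
        field_simp
    _ ≤ _ := le_rfl

lemma s13_polar (m : ℕ) (f : EuclideanSpace ℝ (Fin (2 * m + 3)) → ℝ≥0∞) (hf : Measurable f) :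
    ∫⁻ x, f x = ∫⁻ r in Set.Ioi (0 : ℝ), ENNReal.ofReal (r ^ (2 * m + 2)) *
      ∫⁻ ω, f (r • (ω : EuclideanSpace ℝ (Fin (2 * m + 3))))
        ∂(volume : Measure (EuclideanSpace ℝ (Fin (2 * m + 3)))).toSphere := by
  set μ : Measure (EuclideanSpace ℝ (Fin (2 * m + 3))) := volume
  have hd : Module.finrank ℝ (EuclideanSpace ℝ (Fin (2 * m + 3))) - 1 = 2 * m + 2 := by
    rw [finrank_euclideanSpace_fin]; rfl
  have hm : Measurable (fun p : Metric.sphere (0 : (EuclideanSpace ℝ (Fin (2 * m + 3)))) 1 × Set.Ioi (0 : ℝ) =>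
      f ((p.2 : ℝ) • (p.1 : (EuclideanSpace ℝ (Fin (2 * m + 3)))))) := by fun_prop
  have h1 := μ.measurePreserving_homeomorphUnitSphereProd.lintegral_comp hm
  have h0 : ∫⁻ x, f x ∂μ = ∫⁻ x : ({0}ᶜ : Set (EuclideanSpace ℝ (Fin (2 * m + 3)))), f x ∂(μ.comap (↑)) := by
    rw [lintegral_subtype_comap (measurableSet_singleton _).compl f,
      restrict_compl_singleton]
  rw [h0]
  have h2 : ∀ x : ({0}ᶜ : Set (EuclideanSpace ℝ (Fin (2 * m + 3)))), f (((homeomorphUnitSphereProd (EuclideanSpace ℝ (Fin (2 * m + 3))) x).2 : ℝ) •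
      ((homeomorphUnitSphereProd (EuclideanSpace ℝ (Fin (2 * m + 3))) x).1 : (EuclideanSpace ℝ (Fin (2 * m + 3))))) = f x := by
    intro x
    congr 1
    have hx : ‖(x : (EuclideanSpace ℝ (Fin (2 * m + 3))))‖ ≠ 0 := norm_ne_zero_iff.2 x.2
    simp [smul_smul, hx]
  simp_rw [h2] at h1
  rw [h1, lintegral_prod_symm' _ hm, hd, Measure.volumeIoiPow,
    lintegral_withDensity_eq_lintegral_mul _ (by fun_prop) (by fun_prop)]
  exact lintegral_subtype_comap measurableSet_Ioi (fun r => ENNReal.ofReal (r ^ (2 * m + 2)) *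
      ∫⁻ ω, f (r • (ω : (EuclideanSpace ℝ (Fin (2 * m + 3))))) ∂μ.toSphere)

lemma s13_radial (γ ρ : ℝ) (hγ : 0 < γ) :
    ∫⁻ r in Set.Ioi (0 : ℝ), ENNReal.ofReal (((γ + |r - ρ|)⁻¹) ^ 2) ≤
      ENNReal.ofReal (Real.pi * γ⁻¹) := by
  calc _ ≤ ∫⁻ r : ℝ, ENNReal.ofReal (((γ + |r - ρ|)⁻¹) ^ 2) := setLIntegral_le_lintegral _ _
    _ = ∫⁻ r : ℝ, ENNReal.ofReal (((γ + |r|)⁻¹) ^ 2) :=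
      lintegral_sub_right_eq_self (fun r => ENNReal.ofReal (((γ + |r|)⁻¹) ^ 2)) ρ
    _ ≤ ∫⁻ r : ℝ, ENNReal.ofReal ((γ ^ 2)⁻¹ * (1 + (r / γ) ^ 2)⁻¹) := by
      gcongr with r
      rw [← mul_inv, inv_pow]
      have : γ ^ 2 * (1 + (r / γ) ^ 2) = γ ^ 2 + |r| ^ 2 := by
        rw [sq_abs]; field_simp
      rw [this]
      gcongr
      nlinarith [abs_nonneg r]
    _ = ENNReal.ofReal (∫ r : ℝ, (γ ^ 2)⁻¹ * (1 + (r / γ) ^ 2)⁻¹) := by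
      rw [ofReal_integral_eq_lintegral_ofReal]
      · exact (integrable_inv_one_add_sq.comp_div hγ.ne').const_mul _
      · exact Filter.Eventually.of_forall fun r => by positivity
    _ = _ := by
      rw [integral_const_mul, Measure.integral_comp_div (fun x : ℝ => (1 + x ^ 2)⁻¹),
        integral_univ_inv_one_add_sq, abs_of_pos hγ, smul_eq_mul]
      congr 1
      field_simp

lemma s13_ratio (r ρ a : ℝ) (hr : 0 < r) (hρ : 0 ≤ ρ) (ha : 0 ≤ a) (ha1 : a ≤ 1) :
    r ^ 2 / (r + ρ) ^ 2 ≤ ((1 + r ^ 2) / (1 + ρ ^ 2)) ^ a := by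
  rcases le_total ρ r with h | h
  · calc r ^ 2 / (r + ρ) ^ 2 ≤ 1 := by
          rw [div_le_one (by positivity)]; nlinarith
      _ ≤ _ := by
        apply Real.one_le_rpow _ ha
        rw [one_le_div (by positivity)]; nlinarith
  · calc r ^ 2 / (r + ρ) ^ 2 ≤ ((1 + r ^ 2) / (1 + ρ ^ 2)) ^ (1 : ℝ) := by
          rw [Real.rpow_one, div_le_div_iff₀ (by positivity) (by positivity)]
          nlinarith [sq_nonneg (r * ρ), mul_nonneg hr.le hρ, pow_pos hr 3, mul_nonneg (mul_nonneg hr.le hρ) (sq_nonneg r)]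
      _ ≤ _ := by
        apply Real.rpow_le_rpow_of_exponent_ge (by positivity) _ ha1
        rw [div_le_one (by positivity)]; nlinarith

lemma s13_jap {E : Type*} [NormedAddCommGroup E] (x : E) (s : ℝ) :
    jap x ^ (-(2 * s)) = (1 + ‖x‖ ^ 2) ^ (-s) := by
  rw [jap, Real.sqrt_eq_rpow, ← Real.rpow_mul (by positivity)]
  congr 1; ring

lemma s13_japR (x : ℝ) (s : ℝ) :
    japR x ^ (2 * s) = (1 + x ^ 2) ^ s := by
  rw [japR, Real.sqrt_eq_rpow, ← Real.rpow_mul (by positivity)]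
  congr 1; ring

lemma s13_point (m : ℕ) (s r ρ γ : ℝ) (hr : 0 < r) (hρ : 0 ≤ ρ) (hγ : 0 < γ)
    (hs : (m : ℝ) ≤ s) (hs1 : s ≤ m + 1) :
    r ^ (2 * m + 2) * (hfun γ r ρ ^ 2 * (1 + r ^ 2) ^ (-s)) ≤
      ((γ + |r - ρ|)⁻¹) ^ 2 * (1 + ρ ^ 2) ^ ((m : ℝ) - s) := by
  have h := s13_ratio r ρ (s - m) hr hρ (by linarith) (by linarith)
  rw [Real.div_rpow (by positivity) (by positivity), le_div_iff₀ (by positivity)] at h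
  have e1 : (1 + r ^ 2) ^ (-s) = ((1 + r ^ 2) ^ m)⁻¹ * ((1 + r ^ 2) ^ (s - m))⁻¹ := by
    rw [← Real.rpow_natCast (1 + r ^ 2) m, ← Real.rpow_neg (by positivity), ← Real.rpow_neg (by positivity),
      ← Real.rpow_add (by positivity)]
    congr 1; ring
  have e2 : (1 + ρ ^ 2) ^ ((m : ℝ) - s) = ((1 + ρ ^ 2) ^ (s - m))⁻¹ := by
    rw [← Real.rpow_neg (by positivity)]
    congr 1; ring
  have hX : 0 < (1 + r ^ 2) ^ (s - m) := by positivity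
  have hY : 0 < (1 + ρ ^ 2) ^ (s - m) := by positivity
  rw [e1, e2, hfun, mul_pow, abs_of_nonneg (show 0 ≤ r + ρ by positivity)]
  generalize (1 + r ^ 2) ^ (s - m) = X at *
  generalize (1 + ρ ^ 2) ^ (s - m) = Y at *
  have h1 : r ^ (2 * m) * ((1 + r ^ 2) ^ m)⁻¹ ≤ 1 := by
    rw [← div_eq_mul_inv, div_le_one (by positivity), pow_mul]
    gcongr; linarith
  have h2 : r ^ 2 * ((γ + (r + ρ))⁻¹ ^ 2) * X⁻¹ ≤ Y⁻¹ := by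
    calc r ^ 2 * ((γ + (r + ρ))⁻¹ ^ 2) * X⁻¹ ≤ r ^ 2 * ((r + ρ)⁻¹ ^ 2) * X⁻¹ := by
          have : (γ + (r + ρ))⁻¹ ≤ (r + ρ)⁻¹ := by
            apply inv_anti₀ <;> linarith
          gcongr
      _ = (r ^ 2 / (r + ρ) ^ 2 * Y) * (X⁻¹ * Y⁻¹) := by field_simp
      _ ≤ X * (X⁻¹ * Y⁻¹) := by gcongr
      _ = Y⁻¹ := by field_simp
  calc _ = ((γ + |r - ρ|)⁻¹) ^ 2 * ((r ^ (2 * m) * ((1 + r ^ 2) ^ m)⁻¹) *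
        (r ^ 2 * ((γ + (r + ρ))⁻¹ ^ 2) * X⁻¹)) := by ring
    _ ≤ ((γ + |r - ρ|)⁻¹) ^ 2 * (1 * Y⁻¹) := by gcongr
    _ = _ := by rw [one_mul]

/-- dyadic pointwise bound -/
lemma s13_dyadic (p s r d : ℝ) (hs : 0 ≤ s) (hsp : s ≤ p) (hd : 0 ≤ d) (hr : 0 < r) :
    ENNReal.ofReal ((1 + (r * d) ^ 2) ^ (-s)) ≤ ENNReal.ofReal ((1 + r ^ 2) ^ (-s)) *
      (1 + ∑' k : ℕ, ENNReal.ofReal (((4 : ℝ) ^ p) ^ (k + 1)) *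
        (if d ≤ 1 / ((2 ^ k : ℕ) : ℝ) then 1 else 0)) := by
  have hp : 0 ≤ p := hs.trans hsp
  have hr1 : (0 : ℝ) < (1 + r ^ 2) ^ (-s) := by positivity
  have h4 : (1 : ℝ) ≤ 4 ^ p := Real.one_le_rpow (by norm_num) hp
  rcases le_or_gt 1 d with h1 | h1
  · calc _ ≤ ENNReal.ofReal ((1 + r ^ 2) ^ (-s)) * 1 := by
          rw [mul_one]
          apply ENNReal.ofReal_le_ofReal
          apply Real.rpow_le_rpow_of_nonpos (by positivity) _ (by linarith)
          rw [mul_pow]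
          have : 1 ≤ d ^ 2 := by nlinarith
          nlinarith [sq_nonneg r]
      _ ≤ _ := by gcongr; exact le_self_add
  rcases hd.eq_or_lt with rfl | hd0
  · have : ∑' k : ℕ, ENNReal.ofReal (((4 : ℝ) ^ p) ^ (k + 1)) *
        (if (0 : ℝ) ≤ 1 / ((2 ^ k : ℕ) : ℝ) then 1 else 0) = ⊤ := by
      rw [eq_top_iff, ← ENNReal.tsum_const_eq_top_of_ne_zero (α := ℕ) (one_ne_zero)]
      refine ENNReal.tsum_le_tsum fun k => ?_
      rw [if_pos (by positivity), mul_one, ENNReal.one_le_ofReal]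
      exact one_le_pow₀ h4
    rw [this, add_top, ENNReal.mul_top]
    · exact le_top
    · simpa using hr1
  · obtain ⟨k, hk1, hk2⟩ := exists_nat_pow_near_of_lt_one hd0 h1.le
      (show (0 : ℝ) < 1 / 2 by norm_num) (by norm_num)
    have hk2' : d ≤ 1 / ((2 ^ k : ℕ) : ℝ) := by
      rw [one_div_pow] at hk2; push_cast; exact hk2
    calc _ ≤ ENNReal.ofReal ((1 + r ^ 2) ^ (-s)) * ENNReal.ofReal (((4 : ℝ) ^ p) ^ (k + 1)) := by
          rw [← ENNReal.ofReal_mul hr1.le]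
          apply ENNReal.ofReal_le_ofReal
          have : (1 + r ^ 2) * ((1 / 2 : ℝ) ^ (k + 1)) ^ 2 ≤ 1 + (r * d) ^ 2 := by
            have a1 : ((1 / 2 : ℝ) ^ (k + 1)) ^ 2 ≤ d ^ 2 := by gcongr
            have a2 : d ^ 2 ≤ 1 := by nlinarith
            rw [mul_pow]
            nlinarith [sq_nonneg r]
          calc _ ≤ ((1 + r ^ 2) * ((1 / 2 : ℝ) ^ (k + 1)) ^ 2) ^ (-s) :=
                Real.rpow_le_rpow_of_nonpos (by positivity) this (by linarith)
            _ = (1 + r ^ 2) ^ (-s) * (((1 / 2 : ℝ) ^ (k + 1)) ^ 2) ^ (-s) :=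
                Real.mul_rpow (by positivity) (by positivity)
            _ ≤ _ := by
              gcongr
              have : (((1 / 2 : ℝ) ^ (k + 1)) ^ 2) = ((4 : ℝ) ^ (k + 1))⁻¹ := by
                rw [← pow_mul, mul_comm, pow_mul, ← inv_pow]; norm_num
              rw [this, Real.rpow_neg (by positivity), Real.inv_rpow (by positivity), inv_inv,
                ← Real.rpow_natCast, ← Real.rpow_natCast, ← Real.rpow_mul (by norm_num),
                ← Real.rpow_mul (by norm_num)]
              apply Real.rpow_le_rpow_of_exponent_le (by norm_num)
              rw [mul_comm]
              gcongr
      _ ≤ _ := by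
        gcongr
        refine le_trans ?_ le_add_self
        refine le_trans ?_ (ENNReal.le_tsum k)
        rw [if_pos hk2', mul_one]

lemma s13_sphere (m : ℕ) (p : ℝ) (hp : p < m + 1) :
    ∃ K : ℝ≥0∞, K ≠ ⊤ ∧ ∀ s : ℝ, 0 ≤ s → s ≤ p → ∀ r : ℝ, 0 < r →
      ∀ η : EuclideanSpace ℝ (Fin (2 * m + 3)),
      ∫⁻ ω, ENNReal.ofReal (jap (r • (ω : EuclideanSpace ℝ (Fin (2 * m + 3))) - η) ^ (-(2 * s)))
        ∂(volume : Measure (EuclideanSpace ℝ (Fin (2 * m + 3)))).toSphere ≤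
      ENNReal.ofReal ((1 + r ^ 2) ^ (-s)) * K := by
  set E := EuclideanSpace ℝ (Fin (2 * m + 3))
  set σ := (volume : Measure E).toSphere
  set A : ℝ≥0∞ := (((2 * m + 3 : ℕ) : ℝ≥0∞) * (ENNReal.ofReal (2 ^ (2 * m + 3)) *
      volume (Metric.ball (0 : E) 1))) with hA
  have hAt : A ≠ ⊤ := by
    apply ENNReal.mul_ne_top (ENNReal.natCast_ne_top _)
    exact ENNReal.mul_ne_top ENNReal.ofReal_ne_top measure_ball_lt_top.ne
  set q : ℝ := (4 : ℝ) ^ p / 4 ^ (m + 1) with hq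
  have hq0 : 0 ≤ q := by positivity
  have hq1 : q < 1 := by
    rw [hq, div_lt_one (by positivity), ← Real.rpow_natCast]
    apply Real.rpow_lt_rpow_of_exponent_lt (by norm_num)
    push_cast; exact hp
  refine ⟨σ Set.univ + A * ENNReal.ofReal ((4 : ℝ) ^ p) * (1 - ENNReal.ofReal q)⁻¹, ?_, ?_⟩
  · refine ENNReal.add_ne_top.2 ⟨measure_ne_top _ _, ?_⟩
    refine ENNReal.mul_ne_top (ENNReal.mul_ne_top hAt ENNReal.ofReal_ne_top) ?_
    rw [ENNReal.inv_ne_top]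
    rw [ne_eq, tsub_eq_zero_iff_le, not_le]
    exact ENNReal.ofReal_lt_one.2 hq1
  intro s hs hsp r hr η
  have hmeas : ∀ k : ℕ, MeasurableSet {ω : Metric.sphere (0 : E) 1 |
      ‖(ω : E) - r⁻¹ • η‖ ≤ 1 / ((2 ^ k : ℕ) : ℝ)} := fun k =>
    measurableSet_le (by fun_prop) (by fun_prop)
  calc _ ≤ ∫⁻ ω : Metric.sphere (0 : E) 1, ENNReal.ofReal ((1 + r ^ 2) ^ (-s)) *
      (1 + ∑' k : ℕ, ENNReal.ofReal (((4 : ℝ) ^ p) ^ (k + 1)) *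
        {ω : Metric.sphere (0 : E) 1 |
      ‖(ω : E) - r⁻¹ • η‖ ≤ 1 / ((2 ^ k : ℕ) : ℝ)}.indicator 1 ω) ∂σ := by
        refine lintegral_mono fun ω => ?_
        have h := s13_dyadic p s r ‖(ω : E) - r⁻¹ • η‖ hs hsp (norm_nonneg _) hr
        have e : ‖r • (ω : E) - η‖ = r * ‖(ω : E) - r⁻¹ • η‖ := by
          rw [← abs_of_pos hr, ← Real.norm_eq_abs, ← norm_smul, Real.norm_eq_abs, abs_of_pos hr,
            smul_sub, smul_inv_smul₀ hr.ne']
        simp only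
        rw [s13_jap, e]
        refine h.trans (le_of_eq ?_)
        simp only [Set.indicator_apply, Set.mem_ofPred_eq, Pi.one_apply]
    _ = ENNReal.ofReal ((1 + r ^ 2) ^ (-s)) * (σ Set.univ +
        ∑' k : ℕ, ENNReal.ofReal (((4 : ℝ) ^ p) ^ (k + 1)) * σ {ω : Metric.sphere (0 : E) 1 |
      ‖(ω : E) - r⁻¹ • η‖ ≤ 1 / ((2 ^ k : ℕ) : ℝ)}) := by
        rw [lintegral_const_mul' _ _ ENNReal.ofReal_ne_top, lintegral_add_left measurable_const,
          lintegral_one, lintegral_tsum]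
        · congr 3
          ext k
          rw [lintegral_const_mul' _ _ ENNReal.ofReal_ne_top, lintegral_indicator_one (hmeas k)]
        · intro k
          exact ((measurable_one.indicator (hmeas k)).const_mul _).aemeasurable
    _ ≤ _ := by
        gcongr
        rw [← ENNReal.tsum_geometric, ← ENNReal.tsum_mul_left]
        refine ENNReal.tsum_le_tsum fun k => ?_
        calc _ ≤ ENNReal.ofReal (((4 : ℝ) ^ p) ^ (k + 1)) *
              (A * ENNReal.ofReal ((1 / ((2 ^ k : ℕ) : ℝ)) ^ (2 * m + 2))) := by
              gcongr
              exact s13_cap m (r⁻¹ • η) (2 ^ k) (by positivity)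
          _ = A * (ENNReal.ofReal (((4 : ℝ) ^ p) ^ (k + 1)) *
              ENNReal.ofReal ((1 / ((2 ^ k : ℕ) : ℝ)) ^ (2 * m + 2))) := by ring
          _ = A * (ENNReal.ofReal ((4 : ℝ) ^ p) * ENNReal.ofReal q ^ k) := by
              rw [← ENNReal.ofReal_mul (by positivity), ← ENNReal.ofReal_pow hq0,
                ← ENNReal.ofReal_mul (by positivity)]
              congr 2
              rw [hq, div_pow ((4 : ℝ) ^ p), pow_succ ((4 : ℝ) ^ p), ← pow_mul (4 : ℝ) (m + 1) k]
              have : (1 / ((2 ^ k : ℕ) : ℝ)) ^ (2 * m + 2) = (4 ^ ((m + 1) * k))⁻¹ := by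
                push_cast
                rw [one_div, inv_pow, ← pow_mul, show (4 : ℝ) = 2 ^ 2 by norm_num, ← pow_mul]
                congr 2; ring
              rw [this]; ring
          _ = _ := by ring
          _ ≤ _ := le_rfl

theorem stmt_13 (n m : ℕ) (hn : n = 2 * m + 3) (ε : ℝ) (hε : 0 < ε) (hε1 : ε < 1) :
    ∃ C : ℝ, ∀ s : ℝ, (m : ℝ) ≤ s → s ≤ (m : ℝ) + 1 - ε →
      ∀ η : EuclideanSpace ℝ (Fin n), ∀ ρ : ℝ, 0 ≤ ρ → ∀ γ : ℝ, 0 < γ →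
        ∫ ξ : EuclideanSpace ℝ (Fin n), hfun γ ‖ξ‖ ρ ^ 2 * jap (ξ - η) ^ (-(2 * s)) ≤
          C * γ⁻¹ * japR ρ ^ (2 * (m : ℝ) - 2 * s) := by
  subst hn
  obtain ⟨K, hK, hsph⟩ := s13_sphere m (m + 1 - ε) (by linarith)
  refine ⟨Real.pi * K.toReal, fun s hs hs1 η ρ hρ γ hγ => ?_⟩
  have hs0 : 0 ≤ s := le_trans (by positivity) hs
  have hm : Measurable (fun ξ : EuclideanSpace ℝ (Fin (2 * m + 3)) =>
      hfun γ ‖ξ‖ ρ ^ 2 * jap (ξ - η) ^ (-(2 * s))) := by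
    unfold hfun jap
    fun_prop
  rw [integral_eq_lintegral_of_nonneg_ae _ hm.aestronglyMeasurable]
  swap
  · refine Filter.Eventually.of_forall fun ξ => ?_
    simp only [Pi.zero_apply]
    unfold jap
    positivity
  rw [show 2 * (m : ℝ) - 2 * s = 2 * (m - s) by ring, s13_japR]
  have hR : 0 ≤ (1 + ρ ^ 2) ^ ((m : ℝ) - s) := by positivity
  refine ENNReal.toReal_le_of_le_ofReal (by positivity) ?_
  rw [s13_polar m _ hm.ennreal_ofReal]
  calc _ ≤ ∫⁻ r in Set.Ioi (0 : ℝ), ENNReal.ofReal (((γ + |r - ρ|)⁻¹) ^ 2) *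
        (ENNReal.ofReal ((1 + ρ ^ 2) ^ ((m : ℝ) - s)) * K) := by
        refine setLIntegral_mono' measurableSet_Ioi fun r hr => ?_
        have hr : 0 < r := hr
        have e : ∀ ω : Metric.sphere (0 : EuclideanSpace ℝ (Fin (2 * m + 3))) 1,
            ENNReal.ofReal (hfun γ ‖r • (ω : EuclideanSpace ℝ (Fin (2 * m + 3)))‖ ρ ^ 2 *
              jap (r • (ω : EuclideanSpace ℝ (Fin (2 * m + 3))) - η) ^ (-(2 * s))) =
            ENNReal.ofReal (hfun γ r ρ ^ 2) * ENNReal.ofReal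
              (jap (r • (ω : EuclideanSpace ℝ (Fin (2 * m + 3))) - η) ^ (-(2 * s))) := by
          intro ω
          rw [ENNReal.ofReal_mul (by positivity), norm_smul, norm_eq_of_mem_sphere, mul_one,
            Real.norm_eq_abs, abs_of_pos hr]
        simp_rw [e]
        rw [lintegral_const_mul' _ _ ENNReal.ofReal_ne_top]
        calc _ ≤ ENNReal.ofReal (r ^ (2 * m + 2)) * (ENNReal.ofReal (hfun γ r ρ ^ 2) *
              (ENNReal.ofReal ((1 + r ^ 2) ^ (-s)) * K)) := by
              gcongr
              exact hsph s hs0 hs1 r hr η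
          _ = ENNReal.ofReal (r ^ (2 * m + 2) * (hfun γ r ρ ^ 2 * (1 + r ^ 2) ^ (-s))) * K := by
              rw [ENNReal.ofReal_mul (by positivity), ENNReal.ofReal_mul (by positivity)]
              ring
          _ ≤ ENNReal.ofReal (((γ + |r - ρ|)⁻¹) ^ 2 * (1 + ρ ^ 2) ^ ((m : ℝ) - s)) * K := by
              refine mul_le_mul_left (ENNReal.ofReal_le_ofReal ?_) _
              exact s13_point m s r ρ γ hr hρ hγ hs (by linarith)
          _ = _ := by
              rw [ENNReal.ofReal_mul (by positivity), mul_assoc]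
    _ ≤ ENNReal.ofReal (Real.pi * γ⁻¹) * (ENNReal.ofReal ((1 + ρ ^ 2) ^ ((m : ℝ) - s)) * K) := by
        rw [lintegral_mul_const' _ _ (ENNReal.mul_ne_top ENNReal.ofReal_ne_top hK)]
        gcongr
        exact s13_radial γ ρ hγ
    _ = _ := by
        rw [← ENNReal.ofReal_toReal hK, ENNReal.toReal_ofReal ENNReal.toReal_nonneg,
          ← ENNReal.ofReal_mul hR, ← ENNReal.ofReal_mul (by positivity)]
        congr 1
        ring
    _ ≤ _ := le_rfl
end

section
/- Let n ≥ 1, N ≥ 3, let s₁, …, s_N ≥ 0 be real numbers and let ξ₁, …, ξ_N ∈ ℝⁿ. Then M_{s₁,…,s_N}(ξ₁, …, ξ_N) ≤ 2^{s₂} ⟨ξ₁ + ξ_N⟩^{-s₁} M_{s₂,…,s_N}(ξ₂, …, ξ_N) + 2^{s₁} ⟨ξ₂ − ξ₁⟩^{-s₂} M_{s₁,s₃,…,s_N}(ξ₂, ξ₃, …, ξ_N). -/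
open Finset

/-- `Mfun N s ξ = ⟨ξ₀+ξ_{N-1}⟩^{-s₀} ⟨ξ₁-ξ₀⟩^{-s₁} ⋯ ⟨ξ_{N-1}-ξ_{N-2}⟩^{-s_{N-1}}`
(the function `M_{s₁,…,s_N}(ξ₁,…,ξ_N)` of the paper, with indices shifted to start at `0`). -/
noncomputable def Mfun {E : Type*} [NormedAddCommGroup E] (N : ℕ) (s : ℕ → ℝ) (ξ : ℕ → E) : ℝ :=
  jap (ξ 0 + ξ (N - 1)) ^ (-(s 0)) * ∏ j ∈ Finset.Ico 1 N, jap (ξ j - ξ (j - 1)) ^ (-(s j))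

lemma jap_pos_aux {E : Type*} [NormedAddCommGroup E] (x : E) : 0 < jap x := by
  unfold jap; positivity

lemma jap_le_aux {E : Type*} [NormedAddCommGroup E] (x y : E) (h : ‖x‖ ≤ ‖y‖) :
    jap (x + y) ≤ 2 * jap y := by
  unfold jap
  rw [Real.sqrt_le_left (by positivity), mul_pow, Real.sq_sqrt (by positivity)]
  have h1 := norm_add_le x y
  have h2 : ‖x + y‖ ^ 2 ≤ (2 * ‖y‖) ^ 2 := by
    apply pow_le_pow_left₀ (norm_nonneg _); linarith
  nlinarith

lemma rpow_aux (c b s : ℝ) (hc : 0 < c) (hb : 0 < b) (hs : 0 ≤ s) (h : c ≤ 2 * b) :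
    b ^ (-s) ≤ 2 ^ s * c ^ (-s) := by
  have h1 : (2 * b) ^ (-s) ≤ c ^ (-s) :=
    Real.rpow_le_rpow_of_nonpos hc h (by linarith)
  rw [Real.mul_rpow (by norm_num) hb.le] at h1
  have h2 : (0 : ℝ) < 2 ^ s := by positivity
  calc b ^ (-s) = 2 ^ s * (2 ^ (-s) * b ^ (-s)) := by
        rw [Real.rpow_neg (by norm_num : (0 : ℝ) ≤ 2)]; field_simp
    _ ≤ _ := by gcongr

lemma key_aux {E : Type*} [NormedAddCommGroup E] (a b : E) (s t P : ℝ) (hs : 0 ≤ s) (ht : 0 ≤ t)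
    (hP : 0 ≤ P) :
    jap a ^ (-s) * (jap b ^ (-t) * P) ≤
      2 ^ t * jap a ^ (-s) * (jap (a + b) ^ (-t) * P) +
      2 ^ s * jap b ^ (-t) * (jap (a + b) ^ (-s) * P) := by
  have hA := jap_pos_aux a
  have hB := jap_pos_aux b
  have hC := jap_pos_aux (a + b)
  have p1 : 0 ≤ 2 ^ t * jap a ^ (-s) * (jap (a + b) ^ (-t) * P) := by positivity
  have p2 : 0 ≤ 2 ^ s * jap b ^ (-t) * (jap (a + b) ^ (-s) * P) := by positivity
  rcases le_total ‖a‖ ‖b‖ with h | h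
  · have := rpow_aux _ _ t hC hB ht (jap_le_aux a b h)
    calc _ ≤ jap a ^ (-s) * ((2 ^ t * jap (a + b) ^ (-t)) * P) := by gcongr
      _ = 2 ^ t * jap a ^ (-s) * (jap (a + b) ^ (-t) * P) := by ring
      _ ≤ _ := by linarith
  · have h' := jap_le_aux b a h
    rw [add_comm] at h'
    have := rpow_aux _ _ s hC hA hs h'
    calc _ ≤ (2 ^ s * jap (a + b) ^ (-s)) * (jap b ^ (-t) * P) := by gcongr
      _ = 2 ^ s * jap b ^ (-t) * (jap (a + b) ^ (-s) * P) := by ring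
      _ ≤ _ := by linarith

theorem stmt_15 (n N : ℕ) (hn : 1 ≤ n) (hN : 3 ≤ N)
    (s : ℕ → ℝ) (hs : ∀ j, j < N → 0 ≤ s j) (ξ : ℕ → EuclideanSpace ℝ (Fin n)) :
    Mfun N s ξ ≤
      (2 : ℝ) ^ (s 1) * jap (ξ 0 + ξ (N - 1)) ^ (-(s 0)) *
          Mfun (N - 1) (fun j => s (j + 1)) (fun j => ξ (j + 1)) +
      (2 : ℝ) ^ (s 0) * jap (ξ 1 - ξ 0) ^ (-(s 1)) *
          Mfun (N - 1) (fun j => if j = 0 then s 0 else s (j + 1)) (fun j => ξ (j + 1)) := by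
  obtain ⟨m, rfl⟩ : ∃ m, N = m + 3 := ⟨N - 3, by omega⟩
  have e1 : Mfun (m + 3) s ξ = jap (ξ 0 + ξ (m + 2)) ^ (-(s 0)) * (jap (ξ 1 - ξ 0) ^ (-(s 1)) *
      ∏ j ∈ Finset.Ico 1 (m + 2), jap (ξ (j + 1) - ξ j) ^ (-(s (j + 1)))) := by
    unfold Mfun
    rw [Finset.prod_eq_prod_Ico_succ_bot (by omega)]
    rw [← Finset.prod_Ico_add' (fun j => jap (ξ j - ξ (j - 1)) ^ (-(s j))) 1 (m + 2) 1]
    simp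
  have e2 : ∀ u : ℕ → ℝ, (∀ j, 1 ≤ j → u j = s (j + 1)) →
      Mfun (m + 2) u (fun j => ξ (j + 1)) =
      jap ((ξ 0 + ξ (m + 2)) + (ξ 1 - ξ 0)) ^ (-(u 0)) *
      ∏ j ∈ Finset.Ico 1 (m + 2), jap (ξ (j + 1) - ξ j) ^ (-(s (j + 1))) := by
    intro u hu
    unfold Mfun
    congr 1
    · congr 2
      simp only [zero_add, show m + 2 - 1 + 1 = m + 2 by omega]
      abel
    · apply Finset.prod_congr rfl
      intro j hj
      have hj1 := (Finset.mem_Ico.mp hj).1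
      simp only [hu j hj1, Nat.sub_add_cancel hj1]
  have h0 := hs 0 (by omega)
  have h1 := hs 1 (by omega)
  rw [show m + 3 - 1 = m + 2 by omega, e1, e2 _ (fun j _ => rfl),
    e2 _ (fun j hj => by rw [if_neg (by omega)])]
  simp only [zero_add, if_true]
  exact key_aux _ _ _ _ _ h0 h1
    (Finset.prod_nonneg fun j _ => Real.rpow_nonneg (jap_pos_aux _).le _)
end

section
/- Let n ≥ 3 be an odd integer, set m = (n−3)/2, and let 0 < ε < 1. Then there is a constant C = C(n, ε) such that for all real s₁, s₂ with m ≤ s_j ≤ m + 1 − ε (j = 1, 2), all γ > 0 and all ξ ∈ ℝⁿ, ∫_{ℝⁿ} h_γ(|ξ₁|, |ξ|)² ⟨ξ₁ + ξ⟩^{-2s₁} ⟨ξ − ξ₁⟩^{-2s₂} dξ₁ ≤ C γ^{-1} ⟨ξ⟩^{2m − 2s₁ − 2s₂}. -/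
open MeasureTheory

open Set Metric

section Helpers

variable {E : Type*} [NormedAddCommGroup E] [NormedSpace ℝ E] [MeasurableSpace E] [BorelSpace E]
  [FiniteDimensional ℝ E] (μ : Measure E) [μ.IsAddHaarMeasure]

lemma polar_lintegral_s16 [Nontrivial E] (f : E → ENNReal) (hf : Measurable f) :
    ∫⁻ x, f x ∂μ = ∫⁻ ω : sphere (0 : E) 1, (∫⁻ r in Ioi (0 : ℝ),
      ENNReal.ofReal (r ^ (Module.finrank ℝ E - 1)) * f (r • (ω : E))) ∂μ.toSphere := by
  have h1 : ∫⁻ x, f x ∂μ = ∫⁻ x : ({(0 : E)}ᶜ : Set E), f x.1 ∂(μ.comap (↑)) := by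
    rw [lintegral_subtype_comap (measurableSet_singleton _).compl f,
      restrict_compl_singleton]
  have hm : Measurable (fun p : sphere (0 : E) 1 × Ioi (0 : ℝ) => f (p.2.1 • p.1.1)) := by
    apply hf.comp
    fun_prop
  have h2 := μ.measurePreserving_homeomorphUnitSphereProd.lintegral_comp hm
  rw [h1]
  have h3 : ∀ x : ({(0 : E)}ᶜ : Set E), f x.1 =
      f ((homeomorphUnitSphereProd E x).2.1 • (homeomorphUnitSphereProd E x).1.1) := by
    intro x
    have hx : ‖x.1‖ ≠ 0 := by
      have h0 : (x : E) ≠ 0 := x.2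
      exact norm_ne_zero_iff.2 h0
    simp [smul_smul, hx]
  rw [lintegral_congr h3, h2, lintegral_prod _ hm.aemeasurable]
  congr 1
  ext ω
  rw [Measure.volumeIoiPow, lintegral_withDensity_eq_lintegral_mul]
  · simp only [Pi.mul_apply]
    rw [lintegral_subtype_comap measurableSet_Ioi
      (fun r : ℝ => ENNReal.ofReal (r ^ (Module.finrank ℝ E - 1)) * f (r • (ω : E)))]
  · fun_prop
  · exact hm.comp measurable_prodMk_left

lemma sphere_null (hd : 2 ≤ Module.finrank ℝ E) (θ : E) :
    ∀ᵐ ω : sphere (0 : E) 1 ∂μ.toSphere, (ω : E) ≠ θ := by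
  have hms : MeasurableSet {ω : sphere (0 : E) 1 | (ω : E) = θ} :=
    measurable_subtype_coe (measurableSet_singleton θ)
  rw [ae_iff]
  simp only [ne_eq, not_not]
  rw [Measure.toSphere_apply' _ hms]
  have hz : μ (Submodule.span ℝ {θ} : Submodule ℝ E) = 0 := by
    apply Measure.addHaar_submodule
    intro h
    have := finrank_span_le_card (R := ℝ) ({θ} : Set E)
    rw [h, finrank_top] at this
    simp at this
    omega
  rw [measure_mono_null _ hz, mul_zero]
  rintro x ⟨r, hr, y, ⟨ω, hω, rfl⟩, rfl⟩
  have : (ω : E) = θ := hω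
  simp only [this]
  exact Submodule.smul_mem _ _ (Submodule.mem_span_singleton_self θ)

lemma ball_finite [Nontrivial E] (b : ℝ) (hb : b < Module.finrank ℝ E) :
    ∫⁻ x, (ball (0 : E) 3).indicator (fun x => ENNReal.ofReal (‖x‖ ^ (-b))) x ∂μ < ⊤ := by
  rw [lintegral_indicator measurableSet_ball]
  have hd : 0 < Module.finrank ℝ E := Module.finrank_pos
  have : IntegrableOn (fun x : E => ‖x‖ ^ (-b)) (ball 0 3) μ := by
    rw [integrableOn_fun_norm_addHaar μ (f := fun y : ℝ => y ^ (-b))]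
    have h := (intervalIntegral.intervalIntegrable_rpow' (a := 0) (b := 3)
      (r := (Module.finrank ℝ E : ℝ) - 1 - b) (by linarith)).1
    refine (h.mono_set Ioo_subset_Ioc_self).congr_fun ?_ measurableSet_Ioo
    intro y hy
    have hy0 : 0 < y := hy.1
    simp only [smul_eq_mul]
    rw [← Real.rpow_natCast, ← Real.rpow_add hy0, Nat.cast_sub hd]
    congr 1
    push_cast
    ring
  exact this.lintegral_lt_top

lemma sphere_kernel (hd : 2 ≤ Module.finrank ℝ E) (a : ℝ) (ha : 0 < a)
    (had : a + 1 < Module.finrank ℝ E) :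
    ∃ K : ENNReal, K < ⊤ ∧ ∀ θ : E, ‖θ‖ = 1 →
      ∫⁻ ω : sphere (0 : E) 1, ENNReal.ofReal (‖(ω : E) - θ‖ ^ (-a)) ∂μ.toSphere ≤ K := by
  have : Nontrivial E := Module.nontrivial_of_finrank_pos (R := ℝ) (by omega)
  set g : E → ENNReal :=
    (ball (0 : E) 3).indicator (fun x => ENNReal.ofReal (‖x‖ ^ (-(a + 1)))) with hg
  have hgm : Measurable g := by
    apply Measurable.indicator _ measurableSet_ball
    fun_prop
  have hfin := ball_finite μ (a + 1) had
  refine ⟨ENNReal.ofReal (2 * (3 / 2) ^ (a + 1)) * ∫⁻ x, g x ∂μ,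
    ENNReal.mul_lt_top ENNReal.ofReal_lt_top hfin, ?_⟩
  intro θ hθ
  rw [← lintegral_sub_right_eq_self g θ,
    polar_lintegral_s16 μ (fun x => g (x - θ)) (hgm.comp (measurable_id.sub_const θ))]
  rw [← lintegral_const_mul' _ _ ENNReal.ofReal_ne_top]
  apply lintegral_mono
  intro ω
  have hω : ‖(ω : E)‖ = 1 := by simp
  dsimp only
  set d := ‖(ω : E) - θ‖ with hdd
  rcases (norm_nonneg ((ω : E) - θ)).eq_or_lt with h0 | hpos
  · rw [← hdd] at h0
    rw [← h0, Real.zero_rpow (by linarith)]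
    simp
  rw [← hdd] at hpos
  have hd2 : d ≤ 2 := by
    have := norm_sub_le (ω : E) θ
    rw [hω, hθ] at this
    linarith
  have key : ENNReal.ofReal ((3 / 2 * d) ^ (-(a + 1))) * ENNReal.ofReal (d / 2) ≤
      ∫⁻ r in Ioi (0 : ℝ), ENNReal.ofReal (r ^ (Module.finrank ℝ E - 1)) * g (r • (ω : E) - θ) := by
    calc ENNReal.ofReal ((3 / 2 * d) ^ (-(a + 1))) * ENNReal.ofReal (d / 2)
        = ∫⁻ r in Ioo (1 : ℝ) (1 + d / 2), ENNReal.ofReal ((3 / 2 * d) ^ (-(a + 1))) := by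
          rw [setLIntegral_const, Real.volume_Ioo]
          congr 2
          ring
      _ ≤ ∫⁻ r in Ioo (1 : ℝ) (1 + d / 2),
          ENNReal.ofReal (r ^ (Module.finrank ℝ E - 1)) * g (r • (ω : E) - θ) := by
          apply setLIntegral_mono' measurableSet_Ioo
          rintro r ⟨hr1, hr2⟩
          have hsplit : r • (ω : E) - θ = (r - 1) • (ω : E) + ((ω : E) - θ) := by
            rw [sub_smul, one_smul]; abel
          have hn1 : ‖(r - 1) • (ω : E)‖ = r - 1 := by
            rw [norm_smul, hω, mul_one, Real.norm_eq_abs, abs_of_pos (by linarith)]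
          have hup : ‖r • (ω : E) - θ‖ < 3 / 2 * d := by
            rw [hsplit]
            have := norm_add_le ((r - 1) • (ω : E)) ((ω : E) - θ)
            rw [hn1] at this
            linarith
          have hlo : 0 < ‖r • (ω : E) - θ‖ := by
            have := norm_sub_norm_le (r • (ω : E)) θ
            rw [norm_smul, hω, hθ, Real.norm_eq_abs, abs_of_pos (by linarith)] at this
            linarith
          have hmem : r • (ω : E) - θ ∈ ball (0 : E) 3 := by
            rw [mem_ball_zero_iff]; linarith
          rw [hg, indicator_of_mem hmem]
          have h1 : 1 ≤ ENNReal.ofReal (r ^ (Module.finrank ℝ E - 1)) := by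
            rw [ENNReal.one_le_ofReal]
            exact one_le_pow₀ hr1.le
          calc _ = 1 * ENNReal.ofReal ((3 / 2 * d) ^ (-(a + 1))) := (one_mul _).symm
            _ ≤ _ := mul_le_mul' h1 (ENNReal.ofReal_le_ofReal
              (Real.rpow_le_rpow_of_nonpos hlo hup.le (by linarith)))
      _ ≤ _ := lintegral_mono_set (fun r hr => lt_trans one_pos hr.1)
  calc ENNReal.ofReal (d ^ (-a))
      = ENNReal.ofReal (2 * (3 / 2) ^ (a + 1)) *
        (ENNReal.ofReal ((3 / 2 * d) ^ (-(a + 1))) * ENNReal.ofReal (d / 2)) := by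
        rw [← ENNReal.ofReal_mul (by positivity), ← ENNReal.ofReal_mul (by positivity)]
        congr 1
        rw [Real.mul_rpow (by norm_num) hpos.le, Real.rpow_neg (by norm_num : (0:ℝ) ≤ 3 / 2)]
        have e : d ^ (-a) = d ^ (-(a + 1)) * d := by
          nth_rewrite 3 [← Real.rpow_one d]
          rw [← Real.rpow_add hpos]
          congr 1
          ring
        rw [e]
        have : ((3:ℝ) / 2) ^ (a + 1) ≠ 0 := by positivity
        field_simp
    _ ≤ _ := by gcongr

lemma radial_bound (γ R : ℝ) (hγ : 0 < γ) :
    ∫⁻ r in Ioi (0 : ℝ), ENNReal.ofReal (((γ + |r - R|)⁻¹) ^ 2) ≤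
      ENNReal.ofReal (Real.pi * γ⁻¹) := by
  have hi : Integrable (fun x : ℝ => γ⁻¹ ^ 2 * (1 + (x / γ) ^ 2)⁻¹) :=
    (integrable_inv_one_add_sq.comp_div hγ.ne').const_mul _
  calc ∫⁻ r in Ioi (0 : ℝ), ENNReal.ofReal (((γ + |r - R|)⁻¹) ^ 2)
      ≤ ∫⁻ r : ℝ, ENNReal.ofReal (((γ + |r - R|)⁻¹) ^ 2) := setLIntegral_le_lintegral _ _
    _ = ∫⁻ r : ℝ, ENNReal.ofReal (((γ + |r|)⁻¹) ^ 2) :=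
      lintegral_sub_right_eq_self (fun r => ENNReal.ofReal (((γ + |r|)⁻¹) ^ 2)) R
    _ ≤ ∫⁻ r : ℝ, ENNReal.ofReal (γ⁻¹ ^ 2 * (1 + (r / γ) ^ 2)⁻¹) := by
      apply lintegral_mono
      intro r
      apply ENNReal.ofReal_le_ofReal
      have : γ⁻¹ ^ 2 * (1 + (r / γ) ^ 2)⁻¹ = (γ ^ 2 + r ^ 2)⁻¹ := by
        field_simp
      rw [this, inv_pow]
      apply inv_anti₀ (by positivity)
      nlinarith [abs_nonneg r, sq_abs r]
    _ = _ := by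
      rw [← ofReal_integral_eq_lintegral_ofReal hi (Filter.Eventually.of_forall fun x => by positivity),
        integral_const_mul, Measure.integral_comp_div (fun x : ℝ => (1 + x ^ 2)⁻¹),
        integral_univ_inv_one_add_sq, abs_of_pos hγ, smul_eq_mul]
      congr 1
      field_simp

end Helpers

section Pointwise

lemma one_le_jap {E : Type*} [NormedAddCommGroup E] (x : E) : 1 ≤ jap x := by
  unfold jap
  rw [Real.one_le_sqrt]
  nlinarith [sq_nonneg ‖x‖]

lemma norm_le_jap {E : Type*} [NormedAddCommGroup E] (x : E) : ‖x‖ ≤ jap x := by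
  unfold jap
  apply Real.le_sqrt_of_sq_le
  linarith

lemma jap_le_two {E : Type*} [NormedAddCommGroup E] (x : E) (R : ℝ) (h : ‖x‖ ≤ R) (hR : 1 ≤ R) :
    jap x ≤ 2 * R := by
  unfold jap
  rw [Real.sqrt_le_left (by linarith)]
  nlinarith [norm_nonneg x]

/-- the elementary bound on the radial weights -/
lemma hfun_bound (m : ℕ) (γ r R : ℝ) (hγ : 0 < γ) (hr : 0 < r) (hR : 0 ≤ R) :
    r ^ (2 * m + 2) * hfun γ r R ^ 2 ≤ ((γ + |r - R|)⁻¹) ^ 2 * (max r R) ^ (2 * m) := by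
  unfold hfun
  have hM : 0 < max r R := lt_max_of_lt_left hr
  have h1 : max r R ≤ γ + |r + R| := by
    rw [abs_of_pos (by linarith)]
    apply max_le <;> linarith
  have h2 : (γ + |r + R|)⁻¹ ≤ (max r R)⁻¹ := inv_anti₀ hM h1
  have h3 : 0 < (γ + |r + R|)⁻¹ := inv_pos.2 (lt_of_lt_of_le hM h1)
  calc r ^ (2 * m + 2) * ((γ + |r - R|)⁻¹ * (γ + |r + R|)⁻¹) ^ 2
      = ((γ + |r - R|)⁻¹) ^ 2 * (r ^ (2 * m + 2) * ((γ + |r + R|)⁻¹) ^ 2) := by ring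
    _ ≤ ((γ + |r - R|)⁻¹) ^ 2 * ((max r R) ^ (2 * m + 2) * ((max r R)⁻¹) ^ 2) := by
      gcongr
      exact le_max_left r R
    _ = _ := by
      rw [pow_add]
      field_simp

variable {E : Type*} [NormedAddCommGroup E] [InnerProductSpace ℝ E]

lemma norm_lower (r R : ℝ) (hr : 0 < r) (hR : 0 ≤ R) (ω θ : E) (hω : ‖ω‖ = 1) (hθ : ‖θ‖ = 1) :
    max r R * (‖ω - θ‖ / 2) ≤ ‖r • ω - R • θ‖ := by
  have hab : |r - R| ≤ ‖r • ω - R • θ‖ := by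
    have := abs_norm_sub_norm_le (r • ω) (R • θ)
    rwa [norm_smul, norm_smul, hω, hθ, mul_one, mul_one, Real.norm_of_nonneg hr.le,
      Real.norm_of_nonneg hR] at this
  have e1 : r * ‖ω - θ‖ ≤ 2 * ‖r • ω - R • θ‖ := by
    have h : r • (ω - θ) = (r • ω - R • θ) - (r - R) • θ := by
      simp only [smul_sub, sub_smul]; abel
    have h2 := norm_sub_le (r • ω - R • θ) ((r - R) • θ)
    rw [← h, norm_smul, norm_smul, hθ, Real.norm_of_nonneg hr.le, Real.norm_eq_abs] at h2
    linarith
  have e2 : R * ‖ω - θ‖ ≤ 2 * ‖r • ω - R • θ‖ := by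
    have h : R • (ω - θ) = (r • ω - R • θ) - (r - R) • ω := by
      simp only [smul_sub, sub_smul]; abel
    have h2 := norm_sub_le (r • ω - R • θ) ((r - R) • ω)
    rw [← h, norm_smul, norm_smul, hω, Real.norm_of_nonneg hR, Real.norm_eq_abs] at h2
    linarith
  rcases max_cases r R with ⟨h, _⟩ | ⟨h, _⟩ <;> rw [h] <;> linarith

lemma uv_bound (u v a t₁ t₂ : ℝ) (hu : 0 < u) (hv : 0 < v) (hu1 : u ≤ 1) (hv1 : v ≤ 1)
    (huv : u ^ 2 + v ^ 2 = 1) (h1 : 0 ≤ t₁) (h2 : 0 ≤ t₂) (h1a : t₁ ≤ a) (h2a : t₂ ≤ a) :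
    u ^ (-t₁) * v ^ (-t₂) ≤ 2 ^ a * (u ^ (-a) + v ^ (-a)) := by
  have A : u ^ (-t₁) ≤ u ^ (-a) := Real.rpow_le_rpow_of_exponent_ge hu hu1 (by linarith)
  have B : v ^ (-t₂) ≤ v ^ (-a) := Real.rpow_le_rpow_of_exponent_ge hv hv1 (by linarith)
  have key : ∀ w : ℝ, 1 / 2 ≤ w → w ^ (-a) ≤ 2 ^ a := by
    intro w hw
    have := Real.rpow_le_rpow_of_nonpos (by norm_num : (0:ℝ) < 1 / 2) hw
      (by linarith : -a ≤ 0)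
    rwa [one_div, Real.inv_rpow (by norm_num), Real.rpow_neg (by norm_num : (0:ℝ) ≤ 2),
      inv_inv] at this
  have hp := Real.rpow_pos_of_pos hu (-a)
  have hq := Real.rpow_pos_of_pos hv (-a)
  have h2p : (0:ℝ) < 2 ^ a := by positivity
  have hAB : u ^ (-t₁) * v ^ (-t₂) ≤ u ^ (-a) * v ^ (-a) := by gcongr
  rcases le_total (1 / 2) u with h | h
  · have := mul_le_mul_of_nonneg_right (key u h) hq.le
    nlinarith
  · have hv2 : 1 / 2 ≤ v := by nlinarith
    have := mul_le_mul_of_nonneg_left (key v hv2) hp.le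
    nlinarith

lemma pointwise_large (m : ℕ) (ε : ℝ) (hε : 0 < ε) (s₁ s₂ : ℝ) (h1 : (m : ℝ) ≤ s₁)
    (h1' : s₁ ≤ (m : ℝ) + 1 - ε) (h2 : (m : ℝ) ≤ s₂) (h2' : s₂ ≤ (m : ℝ) + 1 - ε)
    (γ : ℝ) (hγ : 0 < γ) (r R : ℝ) (hr : 0 < r) (hR : 1 ≤ R) (ω θ : E) (hω : ‖ω‖ = 1)
    (hθ : ‖θ‖ = 1) (hne : ω ≠ θ) (hne' : ω ≠ -θ) :
    r ^ (2 * m + 2) * (hfun γ ‖r • ω‖ ‖R • θ‖ ^ 2 * jap (r • ω + R • θ) ^ (-(2 * s₁)) *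
      jap (R • θ - r • ω) ^ (-(2 * s₂))) ≤
    (4 ^ (2 * (m + 1 - ε)) * 2 ^ (2 * (m : ℝ) + 4) *
        jap (R • θ) ^ (2 * (m : ℝ) - 2 * s₁ - 2 * s₂) *
      (‖ω - θ‖ ^ (-(2 * (m + 1 - ε))) + ‖ω - (-θ)‖ ^ (-(2 * (m + 1 - ε))))) *
      ((γ + |r - R|)⁻¹) ^ 2 := by
  set a : ℝ := 2 * (m + 1 - ε) with ha
  set M := max r R with hMdef
  have hm0 : (0:ℝ) ≤ m := Nat.cast_nonneg m
  have hM : 0 < M := lt_max_of_lt_left hr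
  have hRM : R ≤ M := le_max_right _ _
  have hRθ : ‖R • θ‖ = R := by
    rw [norm_smul, hθ, mul_one, Real.norm_of_nonneg (by linarith)]
  have hrω : ‖r • ω‖ = r := by rw [norm_smul, hω, mul_one, Real.norm_of_nonneg hr.le]
  rw [hRθ, hrω]
  set u := ‖ω - (-θ)‖ / 2 with hu
  set v := ‖ω - θ‖ / 2 with hv
  have hu0 : 0 < u := by
    have : 0 < ‖ω - (-θ)‖ := norm_pos_iff.2 (sub_ne_zero.2 hne')
    positivity
  have hv0 : 0 < v := by
    have : 0 < ‖ω - θ‖ := norm_pos_iff.2 (sub_ne_zero.2 hne)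
    positivity
  have huv : u ^ 2 + v ^ 2 = 1 := by
    have := parallelogram_law_with_norm ℝ ω θ
    rw [hω, hθ] at this
    rw [hu, hv, sub_neg_eq_add]
    linarith
  have hu1 : u ≤ 1 := by nlinarith [sq_nonneg v]
  have hv1 : v ≤ 1 := by nlinarith [sq_nonneg u]
  have j1 : M * u ≤ jap (r • ω + R • θ) := by
    have := norm_lower r R hr (by linarith) ω (-θ) hω (by rwa [norm_neg])
    rw [smul_neg, sub_neg_eq_add (r • ω)] at this
    exact this.trans (norm_le_jap _)
  have j2 : M * v ≤ jap (R • θ - r • ω) := by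
    have := norm_lower r R hr (by linarith) ω θ hω hθ
    rw [norm_sub_rev (r • ω)] at this
    exact this.trans (norm_le_jap _)
  have k1 : jap (r • ω + R • θ) ^ (-(2 * s₁)) ≤ M ^ (-(2 * s₁)) * u ^ (-(2 * s₁)) := by
    rw [← Real.mul_rpow hM.le hu0.le]
    exact Real.rpow_le_rpow_of_nonpos (by positivity) j1 (by linarith)
  have k2 : jap (R • θ - r • ω) ^ (-(2 * s₂)) ≤ M ^ (-(2 * s₂)) * v ^ (-(2 * s₂)) := by
    rw [← Real.mul_rpow hM.le hv0.le]
    exact Real.rpow_le_rpow_of_nonpos (by positivity) j2 (by linarith)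
  have kuv := uv_bound u v a (2 * s₁) (2 * s₂) hu0 hv0 hu1 hv1 huv (by linarith) (by linarith)
    (by linarith) (by linarith)
  have kh := hfun_bound m γ r R hγ hr (by linarith)
  rw [← hMdef] at kh
  have kM : M ^ (2 * m) * M ^ (-(2 * s₁)) * M ^ (-(2 * s₂)) ≤
      2 ^ (2 * (m : ℝ) + 4) * jap (R • θ) ^ (2 * (m : ℝ) - 2 * s₁ - 2 * s₂) := by
    have e : M ^ (2 * m) * M ^ (-(2 * s₁)) * M ^ (-(2 * s₂)) =
        M ^ (2 * (m : ℝ) - 2 * s₁ - 2 * s₂) := by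
      rw [← Real.rpow_natCast, ← Real.rpow_add hM, ← Real.rpow_add hM]
      congr 1
      push_cast
      ring
    rw [e]
    have hjp : 0 < jap (R • θ) := lt_of_lt_of_le one_pos (one_le_jap _)
    have hjM : jap (R • θ) / 2 ≤ M := by
      have := jap_le_two (R • θ) R hRθ.le hR
      linarith
    refine (Real.rpow_le_rpow_of_nonpos (by positivity) hjM (by linarith)).trans ?_
    rw [Real.div_rpow hjp.le (by norm_num), div_eq_mul_inv, ← Real.rpow_neg (by norm_num), mul_comm]
    gcongr
    · norm_num
    · linarith
  have hju : 0 ≤ jap (r • ω + R • θ) ^ (-(2 * s₁)) :=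
    Real.rpow_nonneg (zero_le_one.trans (one_le_jap _)) _
  have hjv : 0 ≤ jap (R • θ - r • ω) ^ (-(2 * s₂)) :=
    Real.rpow_nonneg (zero_le_one.trans (one_le_jap _)) _
  have hG : 2 ^ a * (u ^ (-a) + v ^ (-a)) =
      4 ^ a * (‖ω - θ‖ ^ (-a) + ‖ω - (-θ)‖ ^ (-a)) := by
    rw [hu, hv, Real.div_rpow (norm_nonneg _) (by norm_num),
      Real.div_rpow (norm_nonneg _) (by norm_num), Real.rpow_neg (by norm_num : (0:ℝ) ≤ 2),
      div_inv_eq_mul, div_inv_eq_mul, show (4:ℝ) = 2 * 2 by norm_num,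
      Real.mul_rpow (by norm_num) (by norm_num)]
    ring
  calc r ^ (2 * m + 2) * (hfun γ r R ^ 2 * jap (r • ω + R • θ) ^ (-(2 * s₁)) *
      jap (R • θ - r • ω) ^ (-(2 * s₂)))
      = (r ^ (2 * m + 2) * hfun γ r R ^ 2) * (jap (r • ω + R • θ) ^ (-(2 * s₁)) *
      jap (R • θ - r • ω) ^ (-(2 * s₂))) := by ring
    _ ≤ (((γ + |r - R|)⁻¹) ^ 2 * M ^ (2 * m)) *
        ((M ^ (-(2 * s₁)) * u ^ (-(2 * s₁))) * (M ^ (-(2 * s₂)) * v ^ (-(2 * s₂)))) := by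
      gcongr
    _ = (M ^ (2 * m) * M ^ (-(2 * s₁)) * M ^ (-(2 * s₂))) *
        (u ^ (-(2 * s₁)) * v ^ (-(2 * s₂))) * ((γ + |r - R|)⁻¹) ^ 2 := by ring
    _ ≤ (2 ^ (2 * (m : ℝ) + 4) * jap (R • θ) ^ (2 * (m : ℝ) - 2 * s₁ - 2 * s₂)) *
        (2 ^ a * (u ^ (-a) + v ^ (-a))) * ((γ + |r - R|)⁻¹) ^ 2 := by
      have := Real.rpow_nonneg (zero_le_one.trans (one_le_jap (R • θ)))
        (2 * (m : ℝ) - 2 * s₁ - 2 * s₂)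
      gcongr
    _ = _ := by rw [hG]; ring

lemma pointwise_small (m : ℕ) (ε : ℝ) (hε : 0 < ε) (s₁ s₂ : ℝ) (h1 : (m : ℝ) ≤ s₁)
    (h1' : s₁ ≤ (m : ℝ) + 1 - ε) (h2 : (m : ℝ) ≤ s₂) (h2' : s₂ ≤ (m : ℝ) + 1 - ε)
    (γ : ℝ) (hγ : 0 < γ) (r : ℝ) (hr : 0 < r) (ω ξ : E) (hω : ‖ω‖ = 1) (hξ : ‖ξ‖ ≤ 1) :
    r ^ (2 * m + 2) * (hfun γ ‖r • ω‖ ‖ξ‖ ^ 2 * jap (r • ω + ξ) ^ (-(2 * s₁)) *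
      jap (ξ - r • ω) ^ (-(2 * s₂))) ≤
    (2 ^ (2 * m) * 2 ^ (2 * (m : ℝ) + 4) * jap ξ ^ (2 * (m : ℝ) - 2 * s₁ - 2 * s₂)) *
      ((γ + |r - ‖ξ‖|)⁻¹) ^ 2 := by
  have hm0 : (0:ℝ) ≤ m := Nat.cast_nonneg m
  set M := max r ‖ξ‖ with hMdef
  have hM : 0 < M := lt_max_of_lt_left hr
  have hrω : ‖r • ω‖ = r := by rw [norm_smul, hω, mul_one, Real.norm_of_nonneg hr.le]
  rw [hrω]
  have kh := hfun_bound m γ r ‖ξ‖ hγ hr (norm_nonneg _)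
  rw [← hMdef] at kh
  have hj1 : 1 ≤ jap (r • ω + ξ) := one_le_jap _
  have hjpos : 0 < jap (r • ω + ξ) := by linarith
  have hMj : M ≤ 2 * jap (r • ω + ξ) := by
    apply max_le
    · have := norm_sub_le (r • ω + ξ) ξ
      rw [add_sub_cancel_right, hrω] at this
      have := norm_le_jap (r • ω + ξ)
      linarith
    · linarith
  have k1 : M ^ (2 * m) * jap (r • ω + ξ) ^ (-(2 * s₁)) ≤ 2 ^ (2 * m) := by
    calc M ^ (2 * m) * jap (r • ω + ξ) ^ (-(2 * s₁))
        ≤ (2 * jap (r • ω + ξ)) ^ (2 * m) * jap (r • ω + ξ) ^ (-(((2 * m : ℕ)) : ℝ)) := by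
          gcongr
          push_cast; linarith
      _ = _ := by
          rw [Real.rpow_neg hjpos.le, Real.rpow_natCast, mul_pow]
          field_simp
  have k2 : jap (ξ - r • ω) ^ (-(2 * s₂)) ≤ 1 :=
    Real.rpow_le_one_of_one_le_of_nonpos (one_le_jap _) (by linarith)
  have k3 : 1 ≤ 2 ^ (2 * (m : ℝ) + 4) * jap ξ ^ (2 * (m : ℝ) - 2 * s₁ - 2 * s₂) := by
    have hjp : 0 < jap ξ := lt_of_lt_of_le one_pos (one_le_jap _)
    have hj2 : jap ξ ≤ 2 := by
      have := jap_le_two ξ 1 hξ le_rfl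
      linarith
    have q1 := Real.rpow_le_rpow_of_nonpos hjp hj2
      (by linarith : 2 * (m : ℝ) - 2 * s₁ - 2 * s₂ ≤ 0)
    calc (1:ℝ) ≤ 2 ^ ((2 * (m : ℝ) + 4) + (2 * (m : ℝ) - 2 * s₁ - 2 * s₂)) :=
          Real.one_le_rpow (by norm_num) (by linarith)
      _ = 2 ^ (2 * (m : ℝ) + 4) * 2 ^ (2 * (m : ℝ) - 2 * s₁ - 2 * s₂) :=
          Real.rpow_add (by norm_num) _ _
      _ ≤ _ := by gcongr
  have hju : 0 ≤ jap (r • ω + ξ) ^ (-(2 * s₁)) := Real.rpow_nonneg hjpos.le _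
  have hjv : 0 ≤ jap (ξ - r • ω) ^ (-(2 * s₂)) :=
    Real.rpow_nonneg (zero_le_one.trans (one_le_jap _)) _
  calc r ^ (2 * m + 2) * (hfun γ r ‖ξ‖ ^ 2 * jap (r • ω + ξ) ^ (-(2 * s₁)) *
      jap (ξ - r • ω) ^ (-(2 * s₂)))
      = (r ^ (2 * m + 2) * hfun γ r ‖ξ‖ ^ 2) * jap (r • ω + ξ) ^ (-(2 * s₁)) *
      jap (ξ - r • ω) ^ (-(2 * s₂)) := by ring
    _ ≤ (((γ + |r - ‖ξ‖|)⁻¹) ^ 2 * M ^ (2 * m)) * jap (r • ω + ξ) ^ (-(2 * s₁)) * 1 := by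
      gcongr
    _ = ((γ + |r - ‖ξ‖|)⁻¹) ^ 2 * (M ^ (2 * m) * jap (r • ω + ξ) ^ (-(2 * s₁))) := by ring
    _ ≤ ((γ + |r - ‖ξ‖|)⁻¹) ^ 2 * (2 ^ (2 * m) * 1) := by rw [mul_one]; gcongr
    _ ≤ ((γ + |r - ‖ξ‖|)⁻¹) ^ 2 * (2 ^ (2 * m) *
        (2 ^ (2 * (m : ℝ) + 4) * jap ξ ^ (2 * (m : ℝ) - 2 * s₁ - 2 * s₂))) := by gcongr
    _ = _ := by ring

end Pointwise

lemma assemble {E : Type*} [NormedAddCommGroup E] [NormedSpace ℝ E] [MeasurableSpace E]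
    [BorelSpace E] [FiniteDimensional ℝ E] (μ : Measure E) [μ.IsAddHaarMeasure] [Nontrivial E]
    (f : E → ℝ) (hf : Measurable f) (hf0 : ∀ x, 0 ≤ f x) (γ R : ℝ) (hγ : 0 < γ)
    (G : sphere (0 : E) 1 → ℝ) (K B : ℝ) (hB : 0 ≤ B) (hG : Measurable G) (hG0 : ∀ ω, 0 ≤ G ω)
    (hK : 0 ≤ K)
    (hGK : ∫⁻ ω, ENNReal.ofReal (G ω) ∂μ.toSphere ≤ ENNReal.ofReal K)
    (hpt : ∀ᵐ ω : sphere (0 : E) 1 ∂μ.toSphere, ∀ r : ℝ, 0 < r →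
      r ^ (Module.finrank ℝ E - 1) * f (r • (ω : E)) ≤ (B * G ω) * ((γ + |r - R|)⁻¹) ^ 2) :
    ∫ x, f x ∂μ ≤ B * K * (Real.pi * γ⁻¹) := by
  rw [integral_eq_lintegral_of_nonneg_ae (Filter.Eventually.of_forall hf0)
    hf.aestronglyMeasurable]
  apply ENNReal.toReal_le_of_le_ofReal (by positivity)
  rw [polar_lintegral_s16 μ _ hf.ennreal_ofReal]
  calc _ ≤ ∫⁻ ω : sphere (0 : E) 1, ENNReal.ofReal B * ENNReal.ofReal (Real.pi * γ⁻¹) *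
        ENNReal.ofReal (G ω) ∂μ.toSphere := by
        apply lintegral_mono_ae
        filter_upwards [hpt] with ω hω
        calc _ ≤ ∫⁻ r in Ioi (0 : ℝ), ENNReal.ofReal (B * G ω) *
              ENNReal.ofReal (((γ + |r - R|)⁻¹) ^ 2) := by
              apply setLIntegral_mono' measurableSet_Ioi
              intro r hr
              have hr0 : 0 < r := hr
              rw [← ENNReal.ofReal_mul (by positivity),
                ← ENNReal.ofReal_mul (mul_nonneg hB (hG0 ω))]
              exact ENNReal.ofReal_le_ofReal (hω r hr)
          _ = ENNReal.ofReal (B * G ω) * ∫⁻ r in Ioi (0 : ℝ),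
              ENNReal.ofReal (((γ + |r - R|)⁻¹) ^ 2) :=
              lintegral_const_mul' _ _ ENNReal.ofReal_ne_top
          _ ≤ ENNReal.ofReal (B * G ω) * ENNReal.ofReal (Real.pi * γ⁻¹) := by
              gcongr
              exact radial_bound γ R hγ
          _ = _ := by
              rw [ENNReal.ofReal_mul hB]
              ring
    _ = ENNReal.ofReal B * ENNReal.ofReal (Real.pi * γ⁻¹) *
        ∫⁻ ω : sphere (0 : E) 1, ENNReal.ofReal (G ω) ∂μ.toSphere :=
        lintegral_const_mul _ hG.ennreal_ofReal
    _ ≤ ENNReal.ofReal B * ENNReal.ofReal (Real.pi * γ⁻¹) * ENNReal.ofReal K := by gcongr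
    _ = _ := by
        rw [← ENNReal.ofReal_mul hB, ← ENNReal.ofReal_mul (by positivity)]
        congr 1
        ring

lemma jap_measurable {E : Type*} [NormedAddCommGroup E] [MeasurableSpace E] [BorelSpace E] :
    Measurable (jap : E → ℝ) := by
  unfold jap
  fun_prop

theorem stmt_16 (n m : ℕ) (hn : n = 2 * m + 3) (ε : ℝ) (hε : 0 < ε) (hε1 : ε < 1) :
    ∃ C : ℝ, ∀ s₁ s₂ : ℝ, (m : ℝ) ≤ s₁ → s₁ ≤ (m : ℝ) + 1 - ε →
      (m : ℝ) ≤ s₂ → s₂ ≤ (m : ℝ) + 1 - ε →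
      ∀ γ : ℝ, 0 < γ → ∀ ξ : EuclideanSpace ℝ (Fin n),
        ∫ ξ₁ : EuclideanSpace ℝ (Fin n),
            hfun γ ‖ξ₁‖ ‖ξ‖ ^ 2 * jap (ξ₁ + ξ) ^ (-(2 * s₁)) * jap (ξ - ξ₁) ^ (-(2 * s₂)) ≤
          C * γ⁻¹ * jap ξ ^ (2 * (m : ℝ) - 2 * s₁ - 2 * s₂) := by
  have hm0 : (0:ℝ) ≤ m := Nat.cast_nonneg m
  have hfr : Module.finrank ℝ (EuclideanSpace ℝ (Fin n)) = 2 * m + 3 := by simp [hn]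
  have hnt : Nontrivial (EuclideanSpace ℝ (Fin n)) :=
    Module.nontrivial_of_finrank_pos (R := ℝ) (by omega)
  set σ : Measure (sphere (0 : EuclideanSpace ℝ (Fin n)) 1) :=
    (volume : Measure (EuclideanSpace ℝ (Fin n))).toSphere with hσ
  set a : ℝ := 2 * (m + 1 - ε) with ha
  obtain ⟨K, hK, hKθ⟩ := sphere_kernel (volume : Measure (EuclideanSpace ℝ (Fin n)))
    (by omega) a (by linarith) (by rw [hfr]; push_cast; linarith)
  set K1 : ℝ := K.toReal + K.toReal with hK1
  set K2 : ℝ := (σ univ).toReal with hK2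
  have hK10 : 0 ≤ K1 := by positivity
  have hK20 : 0 ≤ K2 := by positivity
  set c1 : ℝ := 4 ^ a * 2 ^ (2 * (m : ℝ) + 4) with hc1
  set c2 : ℝ := 2 ^ (2 * m) * 2 ^ (2 * (m : ℝ) + 4) with hc2
  have hc10 : 0 ≤ c1 := by positivity
  have hc20 : 0 ≤ c2 := by positivity
  refine ⟨(c1 * K1 + c2 * K2) * Real.pi, ?_⟩
  intro s₁ s₂ h1 h1' h2 h2' γ hγ ξ
  set J : ℝ := jap ξ ^ (2 * (m : ℝ) - 2 * s₁ - 2 * s₂) with hJ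
  have hJ0 : 0 ≤ J := Real.rpow_nonneg (zero_le_one.trans (one_le_jap _)) _
  have hγi : 0 < γ⁻¹ := inv_pos.2 hγ
  have hmeas : Measurable (fun ξ₁ : EuclideanSpace ℝ (Fin n) =>
      hfun γ ‖ξ₁‖ ‖ξ‖ ^ 2 * jap (ξ₁ + ξ) ^ (-(2 * s₁)) * jap (ξ - ξ₁) ^ (-(2 * s₂))) := by
    have e1 : Measurable (fun ξ₁ : EuclideanSpace ℝ (Fin n) => jap (ξ₁ + ξ)) :=
      jap_measurable.comp (measurable_id.add_const ξ)
    have e2 : Measurable (fun ξ₁ : EuclideanSpace ℝ (Fin n) => jap (ξ - ξ₁)) :=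
      jap_measurable.comp (measurable_id.const_sub ξ)
    have e3 : Measurable (fun ξ₁ : EuclideanSpace ℝ (Fin n) => hfun γ ‖ξ₁‖ ‖ξ‖) := by
      have q1 : Measurable (fun ξ₁ : EuclideanSpace ℝ (Fin n) => |‖ξ₁‖ - ‖ξ‖|) :=
        (by fun_prop : Continuous _).measurable
      have q2 : Measurable (fun ξ₁ : EuclideanSpace ℝ (Fin n) => |‖ξ₁‖ + ‖ξ‖|) :=
        (by fun_prop : Continuous _).measurable
      exact (q1.const_add γ).inv.mul (q2.const_add γ).inv
    exact ((e3.pow_const 2).mul (e1.pow_const _)).mul (e2.pow_const _)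
  have hnn : ∀ ξ₁ : EuclideanSpace ℝ (Fin n),
      0 ≤ hfun γ ‖ξ₁‖ ‖ξ‖ ^ 2 * jap (ξ₁ + ξ) ^ (-(2 * s₁)) * jap (ξ - ξ₁) ^ (-(2 * s₂)) := by
    intro ξ₁
    have q1 := Real.rpow_nonneg (zero_le_one.trans (one_le_jap (ξ₁ + ξ))) (-(2 * s₁))
    have q2 := Real.rpow_nonneg (zero_le_one.trans (one_le_jap (ξ - ξ₁))) (-(2 * s₂))
    positivity
  rcases le_total ‖ξ‖ 1 with hξ | hξ
  · have := assemble volume _ hmeas hnn γ ‖ξ‖ hγ (fun _ => 1) K2 (c2 * J) (by positivity)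
      measurable_const (fun _ => zero_le_one) hK20
      (by
        rw [ENNReal.ofReal_one, lintegral_one, ← hσ, hK2, ENNReal.ofReal_toReal]
        exact measure_ne_top _ _)
      (by
        refine Filter.Eventually.of_forall fun ω r hr => ?_
        have hp := pointwise_small m ε hε s₁ s₂ h1 h1' h2 h2' γ hγ r hr
          (ω : EuclideanSpace ℝ (Fin n)) ξ (by simp) hξ
        rw [hfr, mul_one]
        exact hp)
    refine this.trans ?_
    have : 0 ≤ c1 * K1 * Real.pi * γ⁻¹ * J := by
      have := Real.pi_pos
      positivity
    nlinarith
  · set R := ‖ξ‖ with hR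
    have hR0 : R ≠ 0 := by linarith
    set θ : EuclideanSpace ℝ (Fin n) := R⁻¹ • ξ with hθd
    have hθ : ‖θ‖ = 1 := by
      rw [hθd, norm_smul, ← hR, Real.norm_of_nonneg (by positivity), inv_mul_cancel₀ hR0]
    have hξθ : ξ = R • θ := by rw [hθd, smul_smul, mul_inv_cancel₀ hR0, one_smul]
    have hfin1 := hKθ θ hθ
    have hfin2 := hKθ (-θ) (by rwa [norm_neg])
    have hme : ∀ η : EuclideanSpace ℝ (Fin n), Measurable
        (fun ω : sphere (0 : EuclideanSpace ℝ (Fin n)) 1 =>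
          ‖(ω : EuclideanSpace ℝ (Fin n)) - η‖ ^ (-a)) := by
      intro η
      have : Measurable (fun ω : sphere (0 : EuclideanSpace ℝ (Fin n)) 1 =>
          ‖(ω : EuclideanSpace ℝ (Fin n)) - η‖) := (by fun_prop : Continuous _).measurable
      exact this.pow_const _
    have := assemble volume _ hmeas hnn γ R hγ
      (fun ω => ‖(ω : EuclideanSpace ℝ (Fin n)) - θ‖ ^ (-a) +
        ‖(ω : EuclideanSpace ℝ (Fin n)) - (-θ)‖ ^ (-a)) K1 (c1 * J) (by positivity)
      ((hme θ).add (hme (-θ))) (fun _ => by positivity) hK10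
      (by
        calc _ = ∫⁻ ω : sphere (0 : EuclideanSpace ℝ (Fin n)) 1,
              (ENNReal.ofReal (‖(ω : EuclideanSpace ℝ (Fin n)) - θ‖ ^ (-a)) +
              ENNReal.ofReal (‖(ω : EuclideanSpace ℝ (Fin n)) - (-θ)‖ ^ (-a))) ∂σ := by
              apply lintegral_congr
              intro ω
              exact ENNReal.ofReal_add (by positivity) (by positivity)
          _ ≤ K + K := by
              rw [lintegral_add_left (hme θ).ennreal_ofReal]
              exact add_le_add hfin1 hfin2
          _ = ENNReal.ofReal K1 := by
              rw [hK1, ENNReal.ofReal_add (by positivity) (by positivity),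
                ENNReal.ofReal_toReal hK.ne])
      (by
        filter_upwards [sphere_null volume (by omega) θ, sphere_null volume (by omega) (-θ)]
          with ω hω hω' r hr
        have hp := pointwise_large m ε hε s₁ s₂ h1 h1' h2 h2' γ hγ r R hr hξ
          (ω : EuclideanSpace ℝ (Fin n)) θ (by simp) hθ hω hω'
        rw [← hξθ] at hp
        rw [hfr]
        exact hp)
    refine this.trans ?_
    have : 0 ≤ c2 * K2 * Real.pi * γ⁻¹ * J := by
      have := Real.pi_pos
      positivity
    nlinarith
end
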